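/- arXiv:2012.08211 — 7 statements merged into one kernel-verified Lean document; each statement's English description precedes it below -/
import Mathlib

section
/- For all integers d, n ≥ 1 there exists a constant C_{d,n} > 0, depending only on d and n, such that for every prime p, every nonconstant polynomial Q ∈ ℤ[X₁,…,Xₙ] of degree at most d, and every integer α ≥ 1, one has H_{p^{-α}Q} · | p^{-nα} Σ_{x ∈ {0,…,p^α−1}^n} exp(2πi Q(x)/p^α) | ≤ C_{d,n} · p. -/
/-- The iterated partial derivative `∂^β P` of a polynomial in `n` variables. -/
noncomputable def mvDeriv {p : ℕ} [Fact p.Prime] {n : ℕ} (β : Fin n → ℕ)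
    (P : MvPolynomial (Fin n) ℚ_[p]) : MvPolynomial (Fin n) ℚ_[p] :=
  (List.finRange n).foldl (fun Q i => (⇑(MvPolynomial.pderiv i))^[β i] Q) P

/-- `H_P(z) = max_{1 ≤ |β| ≤ deg P} |∂^β P(z)/β!|^{1/|β|}` (empty max = 0). -/
noncomputable def HfunMv {p : ℕ} [Fact p.Prime] {n : ℕ} (P : MvPolynomial (Fin n) ℚ_[p])
    (z : Fin n → ℤ_[p]) : NNReal :=
  Finset.univ.sup fun b : Fin n → Fin (P.totalDegree + 1) =>
    if 1 ≤ ∑ i, (b i : ℕ) ∧ ∑ i, (b i : ℕ) ≤ P.totalDegree then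
      ‖MvPolynomial.eval (fun i => ((z i : ℚ_[p])))
          (mvDeriv (fun i => (b i : ℕ)) P) /
          ((∏ i, Nat.factorial (b i) : ℕ) : ℚ_[p])‖₊ ^ ((1 : ℝ) / ((∑ i, (b i : ℕ) : ℕ) : ℝ))
    else 0

/-- `J_P(z) = max_{2 ≤ |β| ≤ deg P} |∂^β P(z)/β!|^{1/|β|}` (empty max = 0). -/
noncomputable def JfunMv {p : ℕ} [Fact p.Prime] {n : ℕ} (P : MvPolynomial (Fin n) ℚ_[p])
    (z : Fin n → ℤ_[p]) : NNReal :=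
  Finset.univ.sup fun b : Fin n → Fin (P.totalDegree + 1) =>
    if 2 ≤ ∑ i, (b i : ℕ) ∧ ∑ i, (b i : ℕ) ≤ P.totalDegree then
      ‖MvPolynomial.eval (fun i => ((z i : ℚ_[p])))
          (mvDeriv (fun i => (b i : ℕ)) P) /
          ((∏ i, Nat.factorial (b i) : ℕ) : ℚ_[p])‖₊ ^ ((1 : ℝ) / ((∑ i, (b i : ℕ) : ℕ) : ℝ))
    else 0

/-- `H_P = inf_{z ∈ ℤ_p^n} H_P(z)`. -/
noncomputable def HinfMv {p : ℕ} [Fact p.Prime] {n : ℕ} (P : MvPolynomial (Fin n) ℚ_[p]) :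
    NNReal :=
  ⨅ z : Fin n → ℤ_[p], HfunMv P z

/-- The polynomial `p^{-α} Q` regarded as an element of `ℚ_p[X₁,…,Xₙ]`. -/
noncomputable def mvScaled (p : ℕ) [Fact p.Prime] {n : ℕ} (α : ℕ)
    (Q : MvPolynomial (Fin n) ℤ) : MvPolynomial (Fin n) ℚ_[p] :=
  MvPolynomial.C (((p : ℚ_[p]) ^ α)⁻¹) * MvPolynomial.map (Int.castRingHom ℚ_[p]) Q

namespace Finsupp

theorem exists_eq_add_single_of_degree_ne_zero {σ : Type*} {m : σ →₀ ℕ} (h : m.degree ≠ 0) :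
    ∃ i γ, m = γ + single i 1 := by
  obtain ⟨i, hi⟩ : ∃ i, m i ≠ 0 := by
    by_contra! h0
    rw [(Finsupp.ext h0 : m = 0), map_zero] at h
    exact h rfl
  exact ⟨i, m - single i 1,
    (tsub_add_cancel_of_le (single_le_iff.2 (Nat.one_le_iff_ne_zero.2 hi))).symm⟩

theorem exists_eq_single_of_degree_eq_one {σ : Type*} {m : σ →₀ ℕ} (h : m.degree = 1) :
    ∃ i, m = single i 1 := by
  obtain ⟨i, γ, rfl⟩ := exists_eq_add_single_of_degree_ne_zero (by omega : m.degree ≠ 0)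
  rw [map_add, degree_single, Nat.add_eq_right, degree_eq_zero_iff] at h
  exact ⟨i, by rw [h, zero_add]⟩

end Finsupp

namespace MvPolynomial

variable {σ R : Type*} [CommRing R]

/-- The polynomial `Q(x + Y)` in the variables `Y`. -/
noncomputable def taylorShift (x : σ → R) : MvPolynomial σ R →ₐ[R] MvPolynomial σ R :=
  aeval fun i => X i + C (x i)

@[simp]
theorem taylorShift_X (x : σ → R) (i : σ) : taylorShift x (X i) = X i + C (x i) :=
  aeval_X _ i

@[simp]
theorem taylorShift_C (x : σ → R) (a : R) : taylorShift x (C a) = C a :=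
  aeval_C _ a

theorem eval_taylorShift (x y : σ → R) (P : MvPolynomial σ R) :
    eval y (taylorShift x P) = eval (fun i => x i + y i) P := by
  induction P using MvPolynomial.induction_on with
  | C a => simp
  | add P Q hP hQ => simp [hP, hQ]
  | mul_X P i hP => simp [hP, add_comm]

theorem map_taylorShift {S : Type*} [CommRing S] (f : R →+* S) (x : σ → R)
    (P : MvPolynomial σ R) :
    map f (taylorShift x P) = taylorShift (fun i => f (x i)) (map f P) := by
  induction P using MvPolynomial.induction_on with
  | C a => simp
  | add P Q hP hQ => simp [hP, hQ]
  | mul_X P i hP => simp [hP]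

theorem pderiv_taylorShift (x : σ → R) (i : σ) (P : MvPolynomial σ R) :
    pderiv i (taylorShift x P) = taylorShift x (pderiv i P) := by
  classical
  induction P using MvPolynomial.induction_on with
  | C a => simp
  | add P Q hP hQ => simp [hP, hQ]
  | mul_X P j hP =>
    have h : taylorShift x (X j) = X j + C (x j) := by simp
    have h' : taylorShift x (pderiv i (X j)) = pderiv i (X j) := by
      by_cases hij : j = i
      · subst hij; simp
      · simp [pderiv_X_of_ne hij]
    simp only [map_mul, pderiv_mul, map_add, hP, h, h', pderiv_C, add_zero]

theorem coeff_iterate_pderiv (i : σ) (k : ℕ) (P : MvPolynomial σ R) (m : σ →₀ ℕ) :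
    coeff m ((pderiv i)^[k] P) =
      ((m i + 1).ascFactorial k : R) * coeff (m + Finsupp.single i k) P := by
  induction k generalizing m with
  | zero => simp
  | succ k ih =>
    rw [Function.iterate_succ_apply', coeff_pderiv, ih]
    have : (m i + 1).ascFactorial (k + 1) = (m i + 1) * (m i + 1 + 1).ascFactorial k := by
      have := Nat.ascFactorial_eq_prod_range (m i + 1) (k + 1)
      rw [this, Finset.prod_range_succ', Nat.ascFactorial_eq_prod_range]
      simp only [add_zero]
      rw [mul_comm]
      congr 1
      exact Finset.prod_congr rfl fun j _ => by ring
    rw [this, add_assoc, ← Finsupp.single_add, add_comm 1 k]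
    simp only [Finsupp.add_apply, Finsupp.single_eq_same]
    push_cast
    ring

theorem coeff_foldl_pderiv (β : σ → ℕ) (L : List σ) (hL : L.Nodup) (P : MvPolynomial σ R)
    (m : σ →₀ ℕ) :
    coeff m (L.foldl (fun Q i => (pderiv i)^[β i] Q) P) =
      (L.map fun i => (((m i + 1).ascFactorial (β i) : ℕ) : R)).prod *
        coeff (m + (L.map fun i => Finsupp.single i (β i)).sum) P := by
  induction L generalizing P with
  | nil => simp
  | cons i L ih =>
    rw [List.nodup_cons] at hL
    rw [List.foldl_cons, ih hL.2, coeff_iterate_pderiv]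
    have : ((L.map fun i => Finsupp.single i (β i)).sum) i = 0 := by
      have h : ∀ L : List σ, i ∉ L → ((L.map fun i => Finsupp.single i (β i)).sum) i = 0 := by
        intro L hi
        induction L with
        | nil => simp
        | cons j L ih =>
          simp only [List.mem_cons, not_or] at hi
          simp [ih hi.2, Finsupp.single_eq_of_ne hi.1]
      exact h L hL.1
    simp only [Finsupp.add_apply, this, add_zero, List.map_cons, List.prod_cons, List.sum_cons]
    rw [mul_assoc, add_assoc, add_comm (List.sum _)]
    ring

/-- A polynomial whose terms of degree at least two vanish at `v` takes there the value of its
affine part. -/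
theorem eval_eq_affine [Fintype σ] [DecidableEq σ] (P : MvPolynomial σ R) (v : σ → R)
    (h : ∀ m : σ →₀ ℕ, 2 ≤ m.degree → coeff m P * ∏ i, v i ^ m i = 0) :
    eval v P = coeff 0 P + ∑ i, coeff (Finsupp.single i 1) P * v i := by
  rw [eval_eq']
  set T : Finset (σ →₀ ℕ) := insert 0 (Finset.univ.image fun i : σ => Finsupp.single i 1)
  have hT : ∀ m ∉ T, coeff m P * ∏ i, v i ^ m i = 0 := by
    intro m hm
    refine h m ?_
    by_contra hlt
    apply hm
    have : m.degree = 0 ∨ m.degree = 1 := by omega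
    rcases this with h0 | h1
    · rw [Finsupp.degree_eq_zero_iff] at h0
      simp [T, h0]
    · obtain ⟨i, rfl⟩ := Finsupp.exists_eq_single_of_degree_eq_one h1
      simp [T]
  rw [Finset.sum_subset (Finset.subset_union_left (s₂ := T)) fun m _ hm => by
      rw [notMem_support_iff.1 hm, zero_mul],
    ← Finset.sum_subset (Finset.subset_union_right (s₁ := P.support)) fun m _ hm => hT m hm]
  rw [Finset.sum_insert, Finset.sum_image]
  · congr 1
    · simp
    · refine Finset.sum_congr rfl fun i _ => ?_
      congr 1
      rw [Finset.prod_eq_single i]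
      · simp
      · intro j _ hj
        simp [Finsupp.single_eq_of_ne hj]
      · simp
  · intro i _ j _ hij
    exact Finsupp.single_left_injective one_ne_zero hij
  · simp

end MvPolynomial

section MvDeriv

variable {p : ℕ} [Fact p.Prime] {n : ℕ}

open MvPolynomial

theorem coeff_mvDeriv (β : Fin n → ℕ) (P : MvPolynomial (Fin n) ℚ_[p]) (m : Fin n →₀ ℕ) :
    coeff m (mvDeriv β P) = (∏ i, (((m i + 1).ascFactorial (β i) : ℕ) : ℚ_[p])) *
      coeff (m + Finsupp.equivFunOnFinite.symm β) P := by
  rw [mvDeriv, coeff_foldl_pderiv _ _ (List.nodup_finRange n), ← List.ofFn_eq_map,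
    ← List.ofFn_eq_map, List.prod_ofFn, List.sum_ofFn]
  congr 3
  ext j
  simp [Finsupp.single_apply]

theorem mvDeriv_taylorShift (β : Fin n → ℕ) (x : Fin n → ℚ_[p])
    (P : MvPolynomial (Fin n) ℚ_[p]) :
    mvDeriv β (taylorShift x P) = taylorShift x (mvDeriv β P) := by
  have h : ∀ (i : Fin n) (k : ℕ) (P : MvPolynomial (Fin n) ℚ_[p]),
      (pderiv i)^[k] (taylorShift x P) = taylorShift x ((pderiv i)^[k] P) := by
    intro i k
    induction k with
    | zero => simp
    | succ k ih =>
      intro P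
      rw [Function.iterate_succ_apply, pderiv_taylorShift, ih, Function.iterate_succ_apply]
  unfold mvDeriv
  generalize List.finRange n = L
  induction L generalizing P with
  | nil => rfl
  | cons i L ih => rw [List.foldl_cons, h, ih, List.foldl_cons]

/-- The values of `∂^β P / β!` are the Taylor coefficients of `P`. -/
theorem eval_mvDeriv (β : Fin n → ℕ) (x : Fin n → ℚ_[p]) (P : MvPolynomial (Fin n) ℚ_[p]) :
    eval x (mvDeriv β P) = ((∏ i, (β i).factorial : ℕ) : ℚ_[p]) *
      coeff (Finsupp.equivFunOnFinite.symm β) (taylorShift x P) := by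
  have h := coeff_mvDeriv β (taylorShift x P) 0
  rw [mvDeriv_taylorShift, zero_add, ← constantCoeff_eq, ← eval_zero, eval_taylorShift] at h
  simpa [Nat.one_ascFactorial] using h

theorem pderiv_mvDeriv (β : Fin n → ℕ) (i : Fin n) (P : MvPolynomial (Fin n) ℚ_[p]) :
    pderiv i (mvDeriv β P) = mvDeriv (β + Pi.single i 1) P := by
  ext m
  rw [coeff_pderiv, coeff_mvDeriv, coeff_mvDeriv]
  have h1 : m + Finsupp.single i 1 + Finsupp.equivFunOnFinite.symm β =
      m + Finsupp.equivFunOnFinite.symm (β + Pi.single i 1) := by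
    ext j
    simp [Finsupp.single_apply, Pi.single_apply, eq_comm]
    ring
  rw [h1, mul_right_comm]
  congr 1
  rw [← Finset.mul_prod_erase _ _ (Finset.mem_univ i),
    ← Finset.mul_prod_erase Finset.univ _ (Finset.mem_univ i), mul_right_comm]
  congr 1
  · simp only [Finsupp.add_apply, Finsupp.single_eq_same, Pi.add_apply, Pi.single_eq_same]
    rw [← Nat.add_descFactorial_eq_ascFactorial, ← Nat.add_descFactorial_eq_ascFactorial]
    have h := Nat.succ_descFactorial (m i + β i) (β i)
    rw [← add_assoc, Nat.descFactorial_succ, add_right_comm (m i) 1]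
    have e : m i + β i + 1 - β i = m i + 1 := by omega
    rw [e]
    push_cast
    ring
  · refine Finset.prod_congr rfl fun j hj => ?_
    have hj' := Finset.ne_of_mem_erase hj
    simp [Finsupp.single_eq_of_ne hj', Pi.single_eq_of_ne hj']

theorem totalDegree_mvDeriv_le (β : Fin n → ℕ) (P : MvPolynomial (Fin n) ℚ_[p]) :
    (mvDeriv β P).totalDegree ≤ P.totalDegree := by
  rw [totalDegree, Finset.sup_le_iff]
  intro m hm
  rw [mem_support_iff, coeff_mvDeriv] at hm
  have h := le_totalDegree (mem_support_iff.2 (right_ne_zero_of_mul hm))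
  refine le_trans ?_ h
  change m.degree ≤ (m + _ : Fin n →₀ ℕ).degree
  rw [map_add]
  exact Nat.le_add_right _ _

end MvDeriv

section RootCount

variable {p : ℕ} [Fact p.Prime]

theorem Padic.one_le_natCast_mul_norm {m : ℕ} (hm : m ≠ 0) : 1 ≤ (m : ℝ) * ‖(m : ℚ_[p])‖ := by
  have hp : 0 < (p : ℝ) := mod_cast (Fact.out : p.Prime).pos
  have hle : (p : ℝ) ^ padicValNat p m ≤ m :=
    mod_cast Nat.le_of_dvd (Nat.pos_of_ne_zero hm) pow_padicValNat_dvd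
  have hnorm : ((p : ℝ) ^ padicValNat p m)⁻¹ ≤ ‖(m : ℚ_[p])‖ := by
    by_contra! hlt
    have h := (Padic.norm_le_pow_iff_norm_lt_pow_add_one (p := p) (m : ℤ)
      (-((padicValNat p m + 1 : ℕ) : ℤ))).2 (by
        rw [← zpow_natCast, ← zpow_neg] at hlt
        simpa using hlt)
    rw [Padic.norm_int_le_pow_iff_dvd] at h
    exact pow_succ_padicValNat_not_dvd hm (by exact_mod_cast h)
  calc (1 : ℝ) = (p : ℝ) ^ padicValNat p m * ((p : ℝ) ^ padicValNat p m)⁻¹ :=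
        (mul_inv_cancel₀ (by positivity)).symm
    _ ≤ m * ‖(m : ℚ_[p])‖ := by gcongr

/-- Where the logarithmic derivative of a polynomial is at least `1 / δ`, there is a root at
distance at most `δ`. -/
theorem Polynomial.exists_root_norm_sub_le (g : Polynomial ℚ_[p]) {δ : ℝ} (t : ℚ_[p])
    (h : ‖g.eval t‖ ≤ δ * ‖g.derivative.eval t‖) (h0 : g.derivative.eval t ≠ 0) :
    ∃ ξ ∈ (g.map (algebraMap ℚ_[p] (PadicAlgCl p))).roots,
      ‖algebraMap ℚ_[p] (PadicAlgCl p) t - ξ‖ ≤ δ := by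
  set φ := algebraMap ℚ_[p] (PadicAlgCl p)
  have hφ : ∀ x, ‖φ x‖ = ‖x‖ := fun x => norm_algebraMap' _ x
  have hg : g ≠ 0 := by
    rintro rfl
    simp at h0
  have hG : g.map φ ≠ 0 := (Polynomial.map_ne_zero_iff φ.injective).2 hg
  have hd : 0 < ‖g.derivative.eval t‖ := norm_pos_iff.2 h0
  by_cases hgt : g.eval t = 0
  · refine ⟨φ t, ?_, ?_⟩
    · rw [Polynomial.mem_roots hG, Polynomial.IsRoot.def, Polynomial.eval_map_algebraMap,
        Polynomial.aeval_algebraMap_apply, Polynomial.coe_aeval_eq_eval, hgt, map_zero]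
    · rw [sub_self, norm_zero]
      by_contra! hlt
      have := mul_neg_of_neg_of_pos hlt hd
      linarith [norm_nonneg (g.eval t)]
  have hev : ∀ f : Polynomial ℚ_[p], (f.map φ).eval (φ t) = φ (f.eval t) := fun f =>
    Polynomial.eval_map_apply φ t
  have hne : (g.map φ).eval (φ t) ≠ 0 := by
    rw [hev]
    exact (_root_.map_ne_zero φ).2 hgt
  have hsum := (IsAlgClosed.splits (g.map φ)).eval_derivative_div_eval_of_ne_zero hne
  rw [Polynomial.derivative_map, hev, hev] at hsum
  have hpos : 0 < ‖g.eval t‖ := norm_pos_iff.2 hgt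
  have hroots : (g.map φ).roots ≠ 0 := by
    intro h
    rw [h, Multiset.map_zero, Multiset.sum_zero, div_eq_zero_iff, map_eq_zero, map_eq_zero] at hsum
    tauto
  obtain ⟨ξ, hξ, hle⟩ := IsUltrametricDist.exists_norm_multiset_sum_le (g.map φ).roots
    (f := fun z => 1 / (φ t - z))
  have hξ := hξ hroots
  refine ⟨ξ, hξ, ?_⟩
  rw [← hsum, norm_div, hφ, hφ, norm_div, norm_one] at hle
  have hξt : 0 < ‖φ t - ξ‖ := by
    rw [norm_pos_iff, sub_ne_zero]
    rintro rfl
    rw [Polynomial.mem_roots hG] at hξ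
    exact hne hξ
  rw [div_le_div_iff₀ hpos hξt, one_mul] at hle
  by_contra! hlt
  have := mul_lt_mul_of_pos_left hlt hd
  linarith

/-- A set of integers in `[0, N)` of `p`-adic diameter at most `δ` is small. -/
theorem card_le_of_padic_diam_le {N : ℕ} {δ : ℝ} (hδ : 0 < δ) (T : Finset ℕ)
    (hT : ∀ t ∈ T, t < N) (hdiam : ∀ t ∈ T, ∀ s ∈ T, ‖(t : ℚ_[p]) - s‖ ≤ δ) :
    (T.card : ℝ) ≤ N * δ + 1 := by
  have hp : 1 < (p : ℝ) := mod_cast (Fact.out : p.Prime).one_lt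
  have hex : ∃ j : ℕ, ((p : ℝ) ^ j)⁻¹ ≤ δ := by
    obtain ⟨j, hj⟩ := pow_unbounded_of_one_lt δ⁻¹ hp
    exact ⟨j, inv_le_of_inv_le₀ hδ hj.le⟩
  classical
  obtain ⟨j, hj, hmin⟩ : ∃ j : ℕ, ((p : ℝ) ^ j)⁻¹ ≤ δ ∧ ∀ i < j, δ < ((p : ℝ) ^ i)⁻¹ :=
    ⟨Nat.find hex, Nat.find_spec hex, fun i hi => not_le.1 (Nat.find_min hex hi)⟩
  have hppos : 0 < p ^ j := pow_pos (Fact.out : p.Prime).pos j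
  have hcong : ∀ t ∈ T, ∀ s ∈ T, t % p ^ j = s % p ^ j := by
    intro t ht s hs
    rcases Nat.eq_zero_or_pos j with rfl | hjpos
    · simp [Nat.mod_one]
    have h1 : ‖((t - s : ℤ) : ℚ_[p])‖ ≤ (p : ℝ) ^ (-j : ℤ) := by
      rw [Padic.norm_le_pow_iff_norm_lt_pow_add_one]
      push_cast
      refine (hdiam t ht s hs).trans_lt ?_
      have := hmin (j - 1) (by omega)
      rwa [← zpow_natCast, ← zpow_neg, Nat.cast_sub hjpos, neg_sub, Nat.cast_one,
        sub_eq_neg_add] at this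
    rw [Padic.norm_int_le_pow_iff_dvd] at h1
    have h2 : (s : ℤ) ≡ t [ZMOD ((p ^ j : ℕ) : ℤ)] := by
      rw [Int.modEq_iff_dvd]
      exact_mod_cast h1
    exact ((Int.natCast_modEq_iff).1 h2).symm
  have hcard : T.card ≤ N / p ^ j + 1 := by
    rw [← Finset.card_range (N / p ^ j + 1)]
    refine Finset.card_le_card_of_injOn (fun t => t / p ^ j) ?_ ?_
    · intro t ht
      simp only [Finset.coe_range, Set.mem_Iio]
      exact Nat.lt_succ_of_le (Nat.div_le_div_right (hT t ht).le)
    · intro t ht s hs hts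
      have := hcong t ht s hs
      simp only at hts
      rw [← Nat.div_add_mod t (p ^ j), ← Nat.div_add_mod s (p ^ j), this, hts]
  have h3 : ((N / p ^ j : ℕ) : ℝ) ≤ N * δ := by
    refine Nat.cast_div_le.trans ?_
    rw [div_eq_mul_inv]
    push_cast
    gcongr
  have h4 : (T.card : ℝ) ≤ ((N / p ^ j : ℕ) : ℝ) + 1 := mod_cast hcard
  linarith

theorem Polynomial.card_norm_eval_le (g : Polynomial ℚ_[p]) {N : ℕ} {δ : ℝ} (hδ : 0 < δ)
    (T : Finset ℕ) (hT : ∀ t ∈ T, t < N)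
    (h : ∀ t ∈ T, ‖g.eval (t : ℚ_[p])‖ ≤ δ * ‖g.derivative.eval (t : ℚ_[p])‖)
    (h0 : ∀ t ∈ T, g.derivative.eval (t : ℚ_[p]) ≠ 0) :
    (T.card : ℝ) ≤ g.natDegree * (N * δ + 1) := by
  classical
  set φ := algebraMap ℚ_[p] (PadicAlgCl p)
  set S := (g.map φ).roots.toFinset
  set F : PadicAlgCl p → Finset ℕ := fun ξ => T.filter fun t : ℕ => ‖φ (t : ℚ_[p]) - ξ‖ ≤ δ
  have hsub : T ⊆ S.biUnion F := by
    intro t ht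
    obtain ⟨ξ, hξ, hle⟩ := g.exists_root_norm_sub_le (t : ℚ_[p]) (h t ht) (h0 t ht)
    rw [Finset.mem_biUnion]
    exact ⟨ξ, Multiset.mem_toFinset.2 hξ, Finset.mem_filter.2 ⟨ht, hle⟩⟩
  have hF : ∀ ξ, ((F ξ).card : ℝ) ≤ N * δ + 1 := by
    intro ξ
    refine card_le_of_padic_diam_le (p := p) hδ _ (fun t ht => hT t (Finset.mem_filter.1 ht).1) ?_
    intro t ht s hs
    rw [← norm_algebraMap' (PadicAlgCl p), map_sub, ← sub_sub_sub_cancel_right _ _ ξ]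
    rw [sub_eq_add_neg]
    refine (IsUltrametricDist.norm_add_le_max _ _).trans ?_
    rw [norm_neg]
    exact max_le (Finset.mem_filter.1 ht).2 (Finset.mem_filter.1 hs).2
  have hS : S.card ≤ g.natDegree :=
    (Multiset.toFinset_card_le _).trans ((Polynomial.card_roots' _).trans Polynomial.natDegree_map_le)
  calc (T.card : ℝ) ≤ (S.biUnion F).card := mod_cast Finset.card_le_card hsub
    _ ≤ ∑ ξ ∈ S, ((F ξ).card : ℝ) := mod_cast Finset.card_biUnion_le
    _ ≤ ∑ ξ ∈ S, (N * δ + 1) := Finset.sum_le_sum fun ξ _ => hF ξ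
    _ = S.card * (N * δ + 1) := by rw [Finset.sum_const, nsmul_eq_mul]
    _ ≤ g.natDegree * (N * δ + 1) := by gcongr

end RootCount

/-- A set all of whose fibers in a fixed coordinate direction are small is small. -/
theorem card_mul_le_of_fiber {ι A : Type*} [Fintype ι] [DecidableEq ι] [Fintype A]
    [DecidableEq A] (E : Finset (ι → A)) (i : ι) {M : ℝ}
    (h : ∀ x : ι → A, ((Finset.univ.filter fun t : A => Function.update x i t ∈ E).card : ℝ) ≤ M) :
    (E.card : ℝ) * Fintype.card A ≤ (Fintype.card A : ℝ) ^ Fintype.card ι * M := by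
  have hinj : (E ×ˢ (Finset.univ : Finset A)).card ≤
      (Finset.univ.sigma fun x : ι → A =>
        Finset.univ.filter fun t : A => Function.update x i t ∈ E).card := by
    refine Finset.card_le_card_of_injOn
      (fun y => ⟨Function.update y.1 i y.2, y.1 i⟩) ?_ ?_
    · rintro ⟨y, s⟩ hy
      simpa using hy
    · rintro ⟨y, s⟩ - ⟨y', s'⟩ - hyy
      simp only [Sigma.mk.injEq, heq_eq_eq] at hyy
      obtain ⟨h1, h2⟩ := hyy
      have h3 : s = s' := by simpa using congrFun h1 i
      subst h3
      have h4 : y = y' := by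
        funext j
        by_cases hj : j = i
        · subst hj; exact h2
        · simpa [hj] using congrFun h1 j
      rw [h4]
  rw [Finset.card_product, Finset.card_sigma] at hinj
  calc (E.card : ℝ) * Fintype.card A
      ≤ ∑ x : ι → A, ((Finset.univ.filter fun t : A => Function.update x i t ∈ E).card : ℝ) := by
        exact_mod_cast hinj
    _ ≤ ∑ _x : ι → A, M := Finset.sum_le_sum fun x _ => h x
    _ = (Fintype.card A : ℝ) ^ Fintype.card ι * M := by
        rw [Finset.sum_const, nsmul_eq_mul, Finset.card_univ, Fintype.card_fun]
        push_cast
        rfl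

section StationaryPhase

variable {N : ℕ} {ι : Type*} [Fintype ι]

/-- On the coset `x + q ^ k ℤ^ι`, the function `f` is affine and not constant. -/
def AffineOnCoset (q : ℕ) (f : (ι → ZMod N) → ZMod N) (k : ℕ) (x : ι → ZMod N) : Prop :=
  ∃ l : ι → ZMod N, l ≠ 0 ∧ ∀ y : ι → ZMod N,
    f (x + (q : ZMod N) ^ k • y) = f x + ∑ i, l i * y i

theorem AffineOnCoset.add {q : ℕ} {f : (ι → ZMod N) → ZMod N} {k j : ℕ} {x : ι → ZMod N}
    (h : AffineOnCoset q f k x) (hkj : k ≤ j) (y : ι → ZMod N) :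
    AffineOnCoset q f k (x + (q : ZMod N) ^ j • y) := by
  obtain ⟨l, hl, h⟩ := h
  refine ⟨l, hl, fun z => ?_⟩
  have e : (q : ZMod N) ^ j • y = (q : ZMod N) ^ k • ((q : ZMod N) ^ (j - k) • y) := by
    rw [smul_smul, ← pow_add, Nat.add_sub_cancel' hkj]
  rw [e, add_assoc, ← smul_add, h, h, add_assoc, ← Finset.sum_add_distrib]
  simp only [Pi.add_apply, mul_add]

theorem affineOnCoset_add_iff {q : ℕ} {f : (ι → ZMod N) → ZMod N} {k j : ℕ} {x : ι → ZMod N}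
    (hkj : k ≤ j) (y : ι → ZMod N) :
    AffineOnCoset q f k (x + (q : ZMod N) ^ j • y) ↔ AffineOnCoset q f k x := by
  refine ⟨fun h => ?_, fun h => h.add hkj y⟩
  simpa using h.add hkj (-y)

theorem sum_stdAddChar_linear [NeZero N] [DecidableEq ι] (l : ι → ZMod N) (hl : l ≠ 0) :
    ∑ y : ι → ZMod N, ZMod.stdAddChar (∑ i, l i * y i) = 0 := by
  obtain ⟨i, hi⟩ := Function.ne_iff.1 hl
  set L : (ι → ZMod N) →+ ZMod N :=
    ⟨⟨fun y => ∑ i, l i * y i, by simp⟩, fun x y => by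
      simp [mul_add, Finset.sum_add_distrib]⟩
  set b : ι → ZMod N := Pi.single i 1
  have hb : ZMod.stdAddChar (L b) ≠ (1 : ℂ) := by
    have : L b = l i := by
      change ∑ j, l j * b j = l i
      rw [Finset.sum_eq_single i] <;> simp +contextual [b]
    rw [this, ← (ZMod.stdAddChar (N := N)).map_zero_eq_one]
    exact fun h => hi (ZMod.injective_stdAddChar h)
  have h₁ : ∑ y, ZMod.stdAddChar (L (b + y)) = ∑ y, (ZMod.stdAddChar (L y) : ℂ) :=
    Fintype.sum_bijective _ (AddGroup.addLeft_bijective b) _ _ fun _ => rfl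
  simp_rw [map_add, AddChar.map_add_eq_mul] at h₁
  rw [← Finset.mul_sum] at h₁
  exact eq_zero_of_mul_eq_self_left hb h₁

open Classical in
/-- The points near which the phase is affine and not constant do not contribute to an
exponential sum. -/
theorem sum_affineOnCoset_eq_zero [NeZero N] [DecidableEq ι] (q : ℕ) (f : (ι → ZMod N) → ZMod N) :
    ∑ x ∈ Finset.univ.filter (fun x => ∃ k, AffineOnCoset q f k x),
      (ZMod.stdAddChar (f x) : ℂ) = 0 := by
  set G := Finset.univ.filter (fun x => ∃ k, AffineOnCoset q f k x)
  set κ : (ι → ZMod N) → ℕ := fun x => sInf {k | AffineOnCoset q f k x}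
  rw [← Finset.sum_fiberwise_of_maps_to (t := G.image κ) (g := κ)
    fun x hx => Finset.mem_image_of_mem κ hx]
  refine Finset.sum_eq_zero fun k _ => ?_
  set E := G.filter fun x => κ x = k
  have hE : ∀ x, x ∈ E ↔ AffineOnCoset q f k x ∧ ∀ j < k, ¬ AffineOnCoset q f j x := by
    intro x
    simp only [E, G, κ, Finset.mem_filter, Finset.mem_univ, true_and]
    constructor
    · rintro ⟨hne, rfl⟩
      exact ⟨Nat.sInf_mem (s := {k | AffineOnCoset q f k x}) hne,
        fun j hj => Nat.notMem_of_lt_sInf hj⟩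
    · rintro ⟨h1, h2⟩
      refine ⟨⟨k, h1⟩, le_antisymm (Nat.sInf_le h1) ?_⟩
      by_contra! hlt
      exact h2 _ hlt (Nat.sInf_mem (s := {k | AffineOnCoset q f k x}) ⟨k, h1⟩)
  have hinv : ∀ x y, x + (q : ZMod N) ^ k • y ∈ E ↔ x ∈ E := by
    intro x y
    rw [hE, hE, affineOnCoset_add_iff le_rfl]
    refine and_congr_right fun _ => forall₂_congr fun j hj => ?_
    rw [affineOnCoset_add_iff hj.le]
  have hshift : ∀ y, ∑ x ∈ E, (ZMod.stdAddChar (f (x + (q : ZMod N) ^ k • y)) : ℂ) =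
      ∑ x ∈ E, (ZMod.stdAddChar (f x) : ℂ) := by
    intro y
    refine Finset.sum_equiv (Equiv.addRight ((q : ZMod N) ^ k • y)) (fun x => ?_) fun x _ => rfl
    exact (hinv x y).symm
  have hsum : ∑ y : ι → ZMod N, ∑ x ∈ E,
      (ZMod.stdAddChar (f (x + (q : ZMod N) ^ k • y)) : ℂ) = 0 := by
    rw [Finset.sum_comm]
    refine Finset.sum_eq_zero fun x hx => ?_
    obtain ⟨l, hl, h⟩ := ((hE x).1 hx).1
    simp_rw [h, AddChar.map_add_eq_mul]
    rw [← Finset.mul_sum, sum_stdAddChar_linear l hl, mul_zero]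
  simp_rw [hshift] at hsum
  rw [Finset.sum_const, nsmul_eq_mul, mul_eq_zero] at hsum
  refine hsum.resolve_left ?_
  rw [Finset.card_univ]
  exact_mod_cast Fintype.card_ne_zero

end StationaryPhase

section PhasePolynomial

open MvPolynomial

theorem affineOnCoset_of_taylorShift {N q k n : ℕ} (Q : MvPolynomial (Fin n) ℤ) (x : Fin n → ℤ)
    (h2 : ∀ m : Fin n →₀ ℕ, 2 ≤ m.degree →
      (N : ℤ) ∣ (q : ℤ) ^ (k * m.degree) * coeff m (taylorShift x Q))
    (h1 : ∃ i, ¬ (N : ℤ) ∣ (q : ℤ) ^ k * coeff (Finsupp.single i 1) (taylorShift x Q)) :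
    AffineOnCoset q (fun y : Fin n → ZMod N => eval y (map (Int.castRingHom (ZMod N)) Q)) k
      (fun i => (x i : ZMod N)) := by
  set R := map (Int.castRingHom (ZMod N)) Q
  set x' : Fin n → ZMod N := fun i => (x i : ZMod N)
  have hcoeff : ∀ m, coeff m (taylorShift x' R) = ((coeff m (taylorShift x Q) : ℤ) : ZMod N) := by
    intro m
    have := congrArg (coeff m) (map_taylorShift (Int.castRingHom (ZMod N)) x Q)
    rw [coeff_map] at this
    exact this.symm
  refine ⟨fun i => (q : ZMod N) ^ k * coeff (Finsupp.single i 1) (taylorShift x' R), ?_, ?_⟩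
  · obtain ⟨i, hi⟩ := h1
    intro h
    apply hi
    rw [← ZMod.intCast_zmod_eq_zero_iff_dvd]
    have := congrFun h i
    simp only [hcoeff] at this
    exact_mod_cast this
  · intro y
    have hvan : ∀ v : Fin n → ZMod N, ∀ m : Fin n →₀ ℕ, 2 ≤ m.degree →
        coeff m (taylorShift x' R) * ∏ i, ((q : ZMod N) ^ k • v) i ^ m i = 0 := by
      intro v m hm
      have h0 : (((q : ℤ) ^ (k * m.degree) * coeff m (taylorShift x Q) : ℤ) : ZMod N) = 0 :=
        (ZMod.intCast_zmod_eq_zero_iff_dvd _ _).2 (h2 m hm)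
      push_cast at h0
      rw [← hcoeff] at h0
      have e : ∏ i, ((q : ZMod N) ^ k • v) i ^ m i =
          (q : ZMod N) ^ (k * m.degree) * ∏ i, v i ^ m i := by
        simp only [Pi.smul_apply, smul_eq_mul, mul_pow, Finset.prod_mul_distrib]
        rw [Finset.prod_pow_eq_pow_sum, ← Finsupp.degree_eq_sum, pow_mul]
      rw [e, ← mul_assoc, mul_comm (coeff _ _), h0, zero_mul]
    have hy := eval_eq_affine (taylorShift x' R) _ (hvan y)
    have h0 := eval_eq_affine (taylorShift x' R) _ (hvan 0)
    rw [eval_taylorShift] at hy h0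
    simp only [smul_zero, Pi.zero_apply, add_zero, mul_zero, Finset.sum_const_zero] at h0
    change eval (fun i => x' i + ((q : ZMod N) ^ k • y) i) R = eval (fun i => x' i) R + _
    rw [hy, h0]
    congr 1
    refine Finset.sum_congr rfl fun i _ => ?_
    simp only [Pi.smul_apply, smul_eq_mul]
    ring

variable {p : ℕ} [Fact p.Prime] {n : ℕ}

theorem coeff_taylorShift_mvScaled (α : ℕ) (Q : MvPolynomial (Fin n) ℤ) (x : Fin n → ℤ)
    (m : Fin n →₀ ℕ) :
    coeff m (taylorShift (fun i => (x i : ℚ_[p])) (mvScaled p α Q)) =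
      ((p : ℚ_[p]) ^ α)⁻¹ * ((coeff m (taylorShift x Q) : ℤ) : ℚ_[p]) := by
  have := congrArg (coeff m) (map_taylorShift (Int.castRingHom ℚ_[p]) x Q)
  rw [coeff_map] at this
  rw [mvScaled, map_mul, taylorShift_C, coeff_C_mul]
  congr 1
  exact this.symm

theorem norm_coeff_taylorShift_mvScaled_le_iff (α k : ℕ) (Q : MvPolynomial (Fin n) ℤ)
    (x : Fin n → ℤ) (m : Fin n →₀ ℕ) :
    ‖coeff m (taylorShift (fun i => (x i : ℚ_[p])) (mvScaled p α Q))‖ ≤ (p : ℝ) ^ k ↔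
      ((p ^ α : ℕ) : ℤ) ∣ (p : ℤ) ^ k * coeff m (taylorShift x Q) := by
  have hp : 0 < (p : ℝ) := mod_cast (Fact.out : p.Prime).pos
  rw [coeff_taylorShift_mvScaled, Nat.cast_pow, ← Padic.norm_int_le_pow_iff_dvd (p := p)]
  push_cast
  rw [norm_mul, norm_mul, norm_inv, norm_pow, norm_pow, Padic.norm_p, zpow_neg, zpow_natCast,
    inv_pow, inv_pow, inv_inv, inv_mul_le_iff₀ (by positivity), ← le_div_iff₀' (by positivity), div_eq_mul_inv]

theorem norm_coeff_taylorShift_mvScaled_le (α : ℕ) (Q : MvPolynomial (Fin n) ℤ)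
    (x : Fin n → ℤ) (m : Fin n →₀ ℕ) :
    ‖coeff m (taylorShift (fun i => (x i : ℚ_[p])) (mvScaled p α Q))‖ ≤ (p : ℝ) ^ α := by
  rw [norm_coeff_taylorShift_mvScaled_le_iff]
  push_cast
  exact dvd_mul_right _ _

theorem degree_le_of_coeff_taylorShift_ne_zero (P : MvPolynomial (Fin n) ℚ_[p])
    (x : Fin n → ℚ_[p]) (m : Fin n →₀ ℕ) (h : coeff m (taylorShift x P) ≠ 0) :
    m.degree ≤ P.totalDegree := by
  have he := eval_mvDeriv (p := p) (⇑m) x P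
  rw [show Finsupp.equivFunOnFinite.symm (⇑m) = m from Equiv.symm_apply_apply _ m] at he
  have hne : eval x (mvDeriv (⇑m) P) ≠ 0 := by
    rw [he]
    refine mul_ne_zero ?_ h
    exact_mod_cast Finset.prod_ne_zero_iff.2 fun i _ => Nat.factorial_ne_zero _
  have hne' : mvDeriv (⇑m) P ≠ 0 := by
    intro h0
    rw [h0, map_zero] at hne
    exact hne rfl
  obtain ⟨j, hj⟩ := MvPolynomial.ne_zero_iff.1 hne'
  rw [coeff_mvDeriv] at hj
  have hle := le_totalDegree (mem_support_iff.2 (right_ne_zero_of_mul hj))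
  refine le_trans ?_ hle
  change m.degree ≤ (j + _ : Fin n →₀ ℕ).degree
  rw [map_add, show Finsupp.equivFunOnFinite.symm (⇑m) = m from Equiv.symm_apply_apply _ m]
  exact Nat.le_add_left _ _

theorem exists_pow_le_norm_coeff_of_le_HfunMv (P : MvPolynomial (Fin n) ℚ_[p])
    (z : Fin n → ℤ_[p]) {H : NNReal} (hH : 0 < H) (h : H ≤ HfunMv P z) :
    ∃ m : Fin n →₀ ℕ, 1 ≤ m.degree ∧
      (H : ℝ) ^ m.degree ≤ ‖coeff m (taylorShift (fun i => (z i : ℚ_[p])) P)‖ := by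
  rw [HfunMv, Finset.le_sup_iff hH] at h
  obtain ⟨b, -, hb⟩ := h
  split_ifs at hb with hc
  · refine ⟨Finsupp.equivFunOnFinite.symm fun i => (b i : ℕ), ?_, ?_⟩
    · rw [Finsupp.degree_eq_sum]
      exact hc.1
    · have hdeg : (Finsupp.equivFunOnFinite.symm fun i => (b i : ℕ)).degree =
          ∑ i, (b i : ℕ) := Finsupp.degree_eq_sum _
      have hfac : ((∏ i, (b i : ℕ).factorial : ℕ) : ℚ_[p]) ≠ 0 := by
        exact_mod_cast Finset.prod_ne_zero_iff.2 fun i _ => Nat.factorial_ne_zero _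
      rw [eval_mvDeriv, mul_div_cancel_left₀ _ hfac, one_div,
        NNReal.le_rpow_inv_iff (by exact_mod_cast hc.1), NNReal.rpow_natCast] at hb
      rw [hdeg]
      exact_mod_cast hb
  · exact absurd hb (not_le.2 hH)

/-- At a point where the phase is on no coset affine and nonconstant, some Taylor coefficient
dominates one of its predecessors. -/
theorem exists_dominant_coeff (α : ℕ) (Q : MvPolynomial (Fin n) ℤ) (x : Fin n → ℤ)
    (hx : ∀ k, ¬ AffineOnCoset p
      (fun y : Fin n → ZMod (p ^ α) => eval y (map (Int.castRingHom (ZMod (p ^ α))) Q)) k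
      (fun i => (x i : ZMod (p ^ α))))
    {H : NNReal} (hH : 1 < H) (hHP : H ≤ HinfMv (mvScaled p α Q)) :
    (H : ℝ) ≤ (p : ℝ) ^ α ∧ ∃ (γ : Fin n →₀ ℕ) (i : Fin n),
      coeff (γ + Finsupp.single i 1)
        (taylorShift (fun i => (x i : ℚ_[p])) (mvScaled p α Q)) ≠ 0 ∧
      ‖coeff γ (taylorShift (fun i => (x i : ℚ_[p])) (mvScaled p α Q))‖ ≤
        p / H * ‖coeff (γ + Finsupp.single i 1)
          (taylorShift (fun i => (x i : ℚ_[p])) (mvScaled p α Q))‖ := by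
  classical
  set A : (Fin n →₀ ℕ) → ℚ_[p] := fun m =>
    coeff m (taylorShift (fun i => (x i : ℚ_[p])) (mvScaled p α Q)) with hA
  have hp1 : 1 < (p : ℝ) := mod_cast (Fact.out : p.Prime).one_lt
  have hp : 0 < (p : ℝ) := by linarith
  have hH0 : 0 < (H : ℝ) := lt_trans zero_lt_one (mod_cast hH)
  have hexists : ∃ k : ℕ, ∀ m : Fin n →₀ ℕ, 2 ≤ m.degree → ‖A m‖ ≤ (p : ℝ) ^ (k * m.degree) := by
    refine ⟨α, fun m hm => ?_⟩
    refine (norm_coeff_taylorShift_mvScaled_le α Q x m).trans ?_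
    exact pow_le_pow_right₀ hp1.le (Nat.le_mul_of_pos_right _ (by omega))
  obtain ⟨k, hk, hkmin⟩ : ∃ k : ℕ,
      (∀ m : Fin n →₀ ℕ, 2 ≤ m.degree → ‖A m‖ ≤ (p : ℝ) ^ (k * m.degree)) ∧
      ∀ j < k, ¬ ∀ m : Fin n →₀ ℕ, 2 ≤ m.degree → ‖A m‖ ≤ (p : ℝ) ^ (j * m.degree) :=
    ⟨Nat.find hexists, Nat.find_spec hexists, fun j hj => Nat.find_min hexists hj⟩
  have hkα : k ≤ α := by
    by_contra! hlt
    refine hkmin α hlt fun m hm => ?_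
    refine (norm_coeff_taylorShift_mvScaled_le α Q x m).trans ?_
    exact pow_le_pow_right₀ hp1.le (Nat.le_mul_of_pos_right _ (by omega))
  have hlin : ∀ m : Fin n →₀ ℕ, m.degree = 1 → ‖A m‖ ≤ (p : ℝ) ^ k := by
    intro m hm
    obtain ⟨i, rfl⟩ := Finsupp.exists_eq_single_of_degree_eq_one hm
    by_contra hnot
    refine hx k (affineOnCoset_of_taylorShift Q x (fun m hm => ?_) ⟨i, fun hdvd => hnot ?_⟩)
    · rw [← norm_coeff_taylorShift_mvScaled_le_iff]
      exact hk m hm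
    · exact (norm_coeff_taylorShift_mvScaled_le_iff α k Q x _).2 hdvd
  have hHk : (H : ℝ) ≤ (p : ℝ) ^ k := by
    have hz : H ≤ HfunMv (mvScaled p α Q) (fun i => ((x i : ℤ) : ℤ_[p])) :=
      hHP.trans (ciInf_le' _ _)
    obtain ⟨m, hm, hle⟩ := exists_pow_le_norm_coeff_of_le_HfunMv _ _ (zero_lt_one.trans hH) hz
    simp only [PadicInt.coe_intCast] at hle
    have hle2 : (H : ℝ) ^ m.degree ≤ ((p : ℝ) ^ k) ^ m.degree := by
      refine hle.trans ?_
      rcases hm.eq_or_lt with h1 | h2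
      · rw [← h1, pow_one]
        exact hlin m h1.symm
      · rw [← pow_mul]
        exact hk m h2
    exact le_of_pow_le_pow_left₀ (by omega) (by positivity) hle2
  refine ⟨hHk.trans (pow_le_pow_right₀ hp1.le hkα), ?_⟩
  obtain ⟨j, rfl⟩ : ∃ j, k = j + 1 := by
    refine Nat.exists_eq_succ_of_ne_zero ?_
    rintro rfl
    rw [pow_zero] at hHk
    exact absurd hHk (not_le.2 (mod_cast hH))
  have hexD : ∃ D : ℕ, ∃ m : Fin n →₀ ℕ, m.degree = D ∧ 2 ≤ D ∧ (p : ℝ) ^ (j * D) < ‖A m‖ := by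
    have := hkmin j (Nat.lt_succ_self j)
    push Not at this
    obtain ⟨m, hm, hlt⟩ := this
    exact ⟨m.degree, m, rfl, hm, hlt⟩
  obtain ⟨D, ⟨m, hmD, hD, hlt⟩, hDmin⟩ : ∃ D : ℕ,
      (∃ m : Fin n →₀ ℕ, m.degree = D ∧ 2 ≤ D ∧ (p : ℝ) ^ (j * D) < ‖A m‖) ∧
      ∀ E < D, ¬ ∃ m : Fin n →₀ ℕ, m.degree = E ∧ 2 ≤ E ∧ (p : ℝ) ^ (j * E) < ‖A m‖ :=
    ⟨Nat.find hexD, Nat.find_spec hexD, fun E hE => Nat.find_min hexD hE⟩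
  obtain ⟨i, γ, rfl⟩ := Finsupp.exists_eq_add_single_of_degree_ne_zero (m := m) (by omega)
  rw [map_add, Finsupp.degree_single] at hmD
  refine ⟨γ, i, fun h0 => ?_, ?_⟩
  · have : A (γ + Finsupp.single i 1) = 0 := h0
    rw [this, norm_zero] at hlt
    exact absurd hlt (not_lt.2 (by positivity))
  have hkey : ‖A γ‖ * (p : ℝ) ^ j ≤ ‖A (γ + Finsupp.single i 1)‖ := by
    rcases hD.eq_or_lt with h2 | h3
    · have h1 := hlin γ (by omega)
      have hge : (p : ℝ) ^ (j * D + 1) ≤ ‖A (γ + Finsupp.single i 1)‖ := by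
        by_contra! hlt'
        have := (Padic.norm_le_pow_iff_norm_lt_pow_add_one (A (γ + Finsupp.single i 1))
          ((j * D : ℕ) : ℤ)).2 (by exact_mod_cast hlt')
        rw [zpow_natCast] at this
        exact absurd hlt (not_lt.2 this)
      calc ‖A γ‖ * (p : ℝ) ^ j ≤ (p : ℝ) ^ (j + 1) * (p : ℝ) ^ j := by gcongr
        _ = (p : ℝ) ^ (j * D + 1) := by rw [← pow_add, ← h2]; congr 1; ring
        _ ≤ _ := hge
    · have h1 : ‖A γ‖ ≤ (p : ℝ) ^ (j * (D - 1)) := by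
        by_contra! hlt'
        exact hDmin (D - 1) (by omega) ⟨γ, by omega, by omega, hlt'⟩
      calc ‖A γ‖ * (p : ℝ) ^ j ≤ (p : ℝ) ^ (j * (D - 1)) * (p : ℝ) ^ j := by gcongr
        _ = (p : ℝ) ^ (j * D) := by
          rw [← pow_add, ← Nat.mul_succ]
          congr 2
          omega
        _ ≤ _ := hlt.le
  rw [div_mul_eq_mul_div, le_div_iff₀ hH0]
  calc ‖A γ‖ * H ≤ ‖A γ‖ * (p : ℝ) ^ (j + 1) := by gcongr
    _ = p * (‖A γ‖ * (p : ℝ) ^ j) := by ring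
    _ ≤ p * ‖A (γ + Finsupp.single i 1)‖ := by gcongr

theorem totalDegree_mvScaled_le (α : ℕ) (Q : MvPolynomial (Fin n) ℤ) :
    (mvScaled p α Q).totalDegree ≤ Q.totalDegree := by
  rw [mvScaled]
  refine (totalDegree_mul _ _).trans ?_
  rw [totalDegree_C, zero_add, totalDegree, Finset.sup_le_iff]
  intro m hm
  exact le_totalDegree (support_map_subset _ _ hm)

theorem derivative_aeval_update (v : Fin n → ℚ_[p]) (i : Fin n)
    (F : MvPolynomial (Fin n) ℚ_[p]) :
    Polynomial.derivative (aeval (Function.update (fun j => Polynomial.C (v j)) i Polynomial.X) F) =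
      aeval (Function.update (fun j => Polynomial.C (v j)) i Polynomial.X) (pderiv i F) := by
  induction F using MvPolynomial.induction_on with
  | C a => simp [Polynomial.algebraMap_eq]
  | add P Q hP hQ => simp only [map_add, hP, hQ]
  | mul_X P j hP =>
    rw [map_mul, Polynomial.derivative_mul, hP, pderiv_mul, map_add, map_mul, map_mul, aeval_X]
    by_cases hij : j = i
    · subst hij; simp
    · simp [Function.update_of_ne hij, pderiv_X_of_ne hij]

theorem eval_aeval_update (v : Fin n → ℚ_[p]) (i : Fin n) (t : ℚ_[p])
    (F : MvPolynomial (Fin n) ℚ_[p]) :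
    Polynomial.eval t
        (aeval (Function.update (fun j => Polynomial.C (v j)) i Polynomial.X) F) =
      eval (Function.update v i t) F := by
  induction F using MvPolynomial.induction_on with
  | C a => simp [Polynomial.algebraMap_eq]
  | add P Q hP hQ => simp only [map_add, Polynomial.eval_add, hP, hQ]
  | mul_X P j hP =>
    rw [map_mul, Polynomial.eval_mul, hP, map_mul, aeval_X, eval_X]
    by_cases hij : j = i
    · subst hij; simp
    · simp [Function.update_of_ne hij]

open Classical in
/-- A sublevel set of the logarithmic derivative in one coordinate direction is small. -/
theorem card_norm_eval_le_pderiv {N : ℕ} [NeZero N] {d : ℕ} {δ : ℝ} (hδ : 0 < δ)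
    (F : MvPolynomial (Fin n) ℚ_[p]) (hF : F.totalDegree ≤ d) (i : Fin n) :
    (((Finset.univ : Finset (Fin n → ZMod N)).filter fun x =>
      eval (fun j => ((x j).val : ℚ_[p])) (pderiv i F) ≠ 0 ∧
      ‖eval (fun j => ((x j).val : ℚ_[p])) F‖ ≤
        δ * ‖eval (fun j => ((x j).val : ℚ_[p])) (pderiv i F)‖).card : ℝ) * N ≤
      (N : ℝ) ^ n * (d * (N * δ + 1)) := by
  have h := card_mul_le_of_fiber (Finset.univ.filter fun x : Fin n → ZMod N =>
      eval (fun j => ((x j).val : ℚ_[p])) (pderiv i F) ≠ 0 ∧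
      ‖eval (fun j => ((x j).val : ℚ_[p])) F‖ ≤
        δ * ‖eval (fun j => ((x j).val : ℚ_[p])) (pderiv i F)‖) i
    (M := d * (N * δ + 1)) ?_
  · simpa [ZMod.card] using h
  intro x
  set v : Fin n → ℚ_[p] := fun j => ((x j).val : ℚ_[p])
  set G := aeval (Function.update (fun j => Polynomial.C (v j)) i Polynomial.X) F
  have hval : ∀ t : ZMod N, (fun j => ((Function.update x i t j).val : ℚ_[p])) =
      Function.update v i (t.val : ℚ_[p]) := by
    intro t
    funext j
    by_cases hj : j = i
    · subst hj; simp
    · simp [hj, v]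
  have hdeg : G.natDegree ≤ d := by
    have := MvPolynomial.aeval_natDegree_le F hF
      (Function.update (fun j => Polynomial.C (v j)) i Polynomial.X) (n := 1) fun j => by
        by_cases hj : j = i
        · subst hj; simp
        · simp [hj]
    simpa using this
  simp only [Finset.mem_filter, Finset.mem_univ, true_and, hval]
  simp only [← eval_aeval_update, ← derivative_aeval_update]
  rw [← Finset.card_image_of_injective _ (ZMod.val_injective N)]
  refine (G.card_norm_eval_le (N := N) hδ _ ?_ ?_ ?_).trans ?_
  · intro t ht
    obtain ⟨s, -, rfl⟩ := Finset.mem_image.1 ht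
    exact ZMod.val_lt s
  · intro t ht
    obtain ⟨s, hs, rfl⟩ := Finset.mem_image.1 ht
    exact (Finset.mem_filter.1 hs).2.2
  · intro t ht
    obtain ⟨s, hs, rfl⟩ := Finset.mem_image.1 ht
    exact (Finset.mem_filter.1 hs).2.1
  · have : 0 ≤ N * δ + 1 := by positivity
    gcongr

open Classical in
/-- There are few points at which the phase is on no coset affine and nonconstant. -/
theorem card_not_affineOnCoset_le (d α : ℕ) (Q : MvPolynomial (Fin n) ℤ)
    (hQ : Q.totalDegree ≤ d) (hd : 1 ≤ d) {H : NNReal} (hH : 1 < H)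
    (hHP : H ≤ HinfMv (mvScaled p α Q)) :
    (((Finset.univ : Finset (Fin n → ZMod (p ^ α))).filter fun x => ¬ ∃ k, AffineOnCoset p
      (fun y => eval y (map (Int.castRingHom (ZMod (p ^ α))) Q)) k x).card : ℝ) * H ≤
      (((d + 1) ^ n * n * (2 * d ^ 2) : ℕ) : ℝ) * p * ((p ^ α : ℕ) : ℝ) ^ n := by
  have hp0 : 0 < p := (Fact.out : p.Prime).pos
  have hp : 0 < (p : ℝ) := mod_cast hp0
  have hH0 : 0 < (H : ℝ) := lt_trans zero_lt_one (mod_cast hH)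
  have hd' : (1 : ℝ) ≤ d := mod_cast hd
  set N := p ^ α with hN
  have : NeZero N := ⟨(pow_pos hp0 α).ne'⟩
  have hN0 : 0 < (N : ℝ) := mod_cast pow_pos hp0 α
  set f : (Fin n → ZMod N) → ZMod N := fun y => eval y (map (Int.castRingHom (ZMod N)) Q)
  set B := (Finset.univ : Finset (Fin n → ZMod N)).filter fun x => ¬ ∃ k, AffineOnCoset p f k x
  set P := mvScaled p α Q with hP
  have hPd : P.totalDegree ≤ d := (totalDegree_mvScaled_le α Q).trans hQ
  set δ : ℝ := d * (p / H) with hδdef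
  have hδ : 0 < δ := by positivity
  set E : (Fin n → Fin (d + 1)) × Fin n → Finset (Fin n → ZMod N) := fun c =>
    Finset.univ.filter fun x =>
      eval (fun j => ((x j).val : ℚ_[p])) (pderiv c.2 (mvDeriv (fun j => (c.1 j : ℕ)) P)) ≠ 0 ∧
      ‖eval (fun j => ((x j).val : ℚ_[p])) (mvDeriv (fun j => (c.1 j : ℕ)) P)‖ ≤
        δ * ‖eval (fun j => ((x j).val : ℚ_[p]))
          (pderiv c.2 (mvDeriv (fun j => (c.1 j : ℕ)) P))‖
  have hdom : ∀ x ∈ B, (H : ℝ) ≤ N ∧ ∃ c, x ∈ E c := by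
    intro x hx
    have hx' := (Finset.mem_filter.1 hx).2
    push Not at hx'
    have hcast : (fun i => (((x i).val : ℤ) : ZMod N)) = x := by
      funext i
      simp
    obtain ⟨hHN, γ, i, hne, hle⟩ := exists_dominant_coeff (p := p) α Q (fun i => ((x i).val : ℤ))
      (fun k => by rw [hcast]; exact hx' k) hH hHP
    refine ⟨by rw [hN]; exact_mod_cast hHN, ?_⟩
    have hdeg := (degree_le_of_coeff_taylorShift_ne_zero _ _ _ hne).trans hPd
    rw [map_add, Finsupp.degree_single] at hdeg
    have hγ : ∀ j, γ j < d + 1 := fun j => by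
      have := Finsupp.le_degree j γ
      omega
    refine ⟨(fun j => ⟨γ j, hγ j⟩, i), Finset.mem_filter.2 ⟨Finset.mem_univ _, ?_⟩⟩
    simp only [Int.cast_natCast] at hne hle
    simp only [pderiv_mvDeriv, eval_mvDeriv]
    have e1 : Finsupp.equivFunOnFinite.symm (fun j => γ j) = γ := Equiv.symm_apply_apply _ γ
    have e2 : Finsupp.equivFunOnFinite.symm ((fun j => γ j) + Pi.single i 1) =
        γ + Finsupp.single i 1 := by
      ext j
      simp [Finsupp.single_apply, Pi.single_apply, eq_comm]
    have e3 : ∏ j, (((fun j => γ j) + Pi.single i 1 : Fin n → ℕ) j).factorial =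
        (γ i + 1) * ∏ j, (γ j).factorial := by
      rw [← Finset.mul_prod_erase _ _ (Finset.mem_univ i),
        ← Finset.mul_prod_erase Finset.univ (fun j => (γ j).factorial) (Finset.mem_univ i),
        ← mul_assoc]
      congr 1
      · simp [Nat.factorial_succ]
      · refine Finset.prod_congr rfl fun j hj => ?_
        simp [Pi.single_eq_of_ne (Finset.ne_of_mem_erase hj)]
    rw [e1, e2, e3, Nat.cast_mul, norm_mul, norm_mul, norm_mul]
    have hfac : ((∏ j, (γ j).factorial : ℕ) : ℚ_[p]) ≠ 0 := by
      exact_mod_cast Finset.prod_ne_zero_iff.2 fun i _ => Nat.factorial_ne_zero _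
    have hγ1 : ((γ i + 1 : ℕ) : ℚ_[p]) ≠ 0 := Nat.cast_ne_zero.2 (Nat.succ_ne_zero _)
    refine ⟨mul_ne_zero (mul_ne_zero hγ1 hfac) hne, ?_⟩
    have hnorm : 1 ≤ d * ‖((γ i + 1 : ℕ) : ℚ_[p])‖ := by
      have h1 := Padic.one_le_natCast_mul_norm (p := p) (Nat.succ_ne_zero (γ i))
      refine h1.trans ?_
      have : γ i + 1 ≤ d := by
        have := Finsupp.le_degree i γ
        omega
      gcongr
    set a := ‖((∏ j, (γ j).factorial : ℕ) : ℚ_[p])‖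
    set b := ‖coeff (γ + Finsupp.single i 1) (taylorShift (fun j => ((x j).val : ℚ_[p])) P)‖
    calc _ ≤ a * (p / H * b) := by gcongr
      _ ≤ (d * ‖((γ i + 1 : ℕ) : ℚ_[p])‖) * (a * (p / H * b)) :=
        le_mul_of_one_le_left (by positivity) hnorm
      _ = _ := by rw [hδdef]; ring
  rcases B.eq_empty_or_nonempty with hB | ⟨x₀, hx₀⟩
  · rw [hB, Finset.card_empty, Nat.cast_zero, zero_mul]
    positivity
  have hHN := (hdom x₀ hx₀).1
  have hNδ : 1 ≤ N * δ := by
    have hp1 : (1 : ℝ) ≤ p := mod_cast hp0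
    have : 1 ≤ (N : ℝ) / H := (one_le_div hH0).2 hHN
    calc (1 : ℝ) ≤ d * p * (N / H) := one_le_mul_of_one_le_of_one_le
          (one_le_mul_of_one_le_of_one_le hd' hp1) this
      _ = N * δ := by rw [hδdef]; ring
  have hE : ∀ c, ((E c).card : ℝ) ≤ (N : ℝ) ^ n * (d * (2 * δ)) := by
    intro c
    have h := card_norm_eval_le_pderiv (N := N) hδ (mvDeriv (fun j => (c.1 j : ℕ)) P)
      ((totalDegree_mvDeriv_le _ P).trans hPd) c.2
    have h' : ((E c).card : ℝ) * N ≤ (N : ℝ) ^ n * (d * (2 * δ)) * N := by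
      refine h.trans ?_
      rw [mul_assoc]
      gcongr ?_ * ?_
      rw [mul_assoc]
      gcongr
      linarith
    exact le_of_mul_le_mul_right h' hN0
  have hsub : B ⊆ Finset.univ.biUnion E := fun x hx => by
    obtain ⟨c, hc⟩ := (hdom x hx).2
    exact Finset.mem_biUnion.2 ⟨c, Finset.mem_univ _, hc⟩
  have hcard : (B.card : ℝ) ≤ ((d + 1) ^ n * n : ℕ) * ((N : ℝ) ^ n * (d * (2 * δ))) := by
    calc (B.card : ℝ) ≤ (Finset.univ.biUnion E).card := mod_cast Finset.card_le_card hsub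
      _ ≤ ∑ c, ((E c).card : ℝ) := mod_cast Finset.card_biUnion_le
      _ ≤ ∑ _c : (Fin n → Fin (d + 1)) × Fin n, (N : ℝ) ^ n * (d * (2 * δ)) :=
        Finset.sum_le_sum fun c _ => hE c
      _ = _ := by
        rw [Finset.sum_const, nsmul_eq_mul, Finset.card_univ]
        simp
  calc (B.card : ℝ) * H
      ≤ ((d + 1) ^ n * n : ℕ) * ((N : ℝ) ^ n * (d * (2 * δ))) * H := by gcongr
    _ = _ := by
      rw [hδdef]
      push_cast [hN]
      field_simp

theorem sum_exp_eq_sum_stdAddChar {N : ℕ} [NeZero N] (Q : MvPolynomial (Fin n) ℤ) :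
    ∑ x ∈ Fintype.piFinset fun _ : Fin n => Finset.range N,
      Complex.exp (2 * (Real.pi : ℂ) * Complex.I *
        ((eval (fun i => ((x i : ℤ))) Q : ℤ) : ℂ) / (N : ℂ)) =
      ∑ x : Fin n → ZMod N,
        ZMod.stdAddChar (eval x (map (Int.castRingHom (ZMod N)) Q)) := by
  have hval : ∀ x : Fin n → ℕ, ((eval (fun i => ((x i : ℤ))) Q : ℤ) : ZMod N) =
      eval (fun i => (x i : ZMod N)) (map (Int.castRingHom (ZMod N)) Q) := by
    intro x
    have := map_eval (Int.castRingHom (ZMod N)) (fun i => (x i : ℤ)) Q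
    simpa [Function.comp_def] using this
  refine Finset.sum_nbij' (fun x i => (x i : ZMod N)) (fun x i => (x i).val) ?_ ?_ ?_ ?_ ?_
  · simp
  · intro x _
    simpa using fun i => ZMod.val_lt (x i)
  · intro x hx
    funext i
    rw [Fintype.mem_piFinset] at hx
    exact ZMod.val_cast_of_lt (Finset.mem_range.1 (hx i))
  · intro x _
    funext i
    simp
  · intro x _
    rw [← hval, ZMod.stdAddChar_coe]

end PhasePolynomial

/-- Multivariable oscillatory integral bound (Theorem 1.5 for complete sums): for `d, n ≥ 1`
there is `C_{d,n} > 0` such that for every prime `p`, every nonconstant `Q ∈ ℤ[X₁,…,Xₙ]` of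
degree at most `d`, and every `α ≥ 1`,
`H_{p^{-α}Q} · |p^{-nα} ∑_{x ∈ {0,…,p^α-1}^n} e^{2πi Q(x)/p^α}| ≤ C_{d,n} · p`. -/
theorem mv_exp_sum_bound (d n : ℕ) (hd : 1 ≤ d) (hn : 1 ≤ n) :
    ∃ C : ℝ, 0 < C ∧
      ∀ (p : ℕ) [Fact p.Prime],
        ∀ Q : MvPolynomial (Fin n) ℤ, Q.totalDegree ≤ d → Q.totalDegree ≠ 0 →
          ∀ α : ℕ, 1 ≤ α →
            (HinfMv (mvScaled p α Q) : ℝ) *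
              ‖((p : ℂ) ^ (n * α))⁻¹ *
                  ∑ x ∈ Fintype.piFinset fun _ : Fin n => Finset.range (p ^ α),
                    Complex.exp (2 * (Real.pi : ℂ) * Complex.I *
                      ((MvPolynomial.eval (fun i => ((x i : ℤ))) Q : ℤ) : ℂ) / (p : ℂ) ^ α)‖ ≤
              C * p := by
  classical
  refine ⟨(1 + (d + 1) ^ n * n * (2 * d ^ 2) : ℕ), by positivity, ?_⟩
  intro p _ Q hQ _ α _
  have hp0 : 0 < p := (Fact.out : p.Prime).pos
  have hp : (1 : ℝ) ≤ p := mod_cast hp0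
  have hN : 0 < p ^ α := pow_pos hp0 α
  have : NeZero (p ^ α) := ⟨hN.ne'⟩
  have hNn : 0 < ((p ^ α : ℕ) : ℝ) ^ n := by positivity
  have hsum := sum_exp_eq_sum_stdAddChar (N := p ^ α) Q
  rw [Nat.cast_pow] at hsum
  rw [hsum, norm_mul, norm_inv, mul_comm n α, pow_mul, ← Nat.cast_pow, norm_pow, Complex.norm_natCast]
  set f : (Fin n → ZMod (p ^ α)) → ZMod (p ^ α) :=
    fun y => MvPolynomial.eval y (MvPolynomial.map (Int.castRingHom (ZMod (p ^ α))) Q)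
  have hnorm : ∀ S : Finset (Fin n → ZMod (p ^ α)),
      ‖∑ x ∈ S, (ZMod.stdAddChar (f x) : ℂ)‖ ≤ S.card := by
    intro S
    refine (norm_sum_le _ _).trans ?_
    simp
  set H := HinfMv (mvScaled p α Q)
  have hC : (0 : ℝ) ≤ (((d + 1) ^ n * n * (2 * d ^ 2) : ℕ) : ℝ) := Nat.cast_nonneg _
  rw [mul_left_comm, inv_mul_le_iff₀ hNn]
  rw [Nat.cast_add, Nat.cast_one]
  rcases le_or_gt H 1 with hH | hH
  · have h1 := hnorm Finset.univ
    rw [Finset.card_univ, Fintype.card_fun, ZMod.card, Fintype.card_fin, Nat.cast_pow] at h1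
    have hH' : (H : ℝ) ≤ 1 := mod_cast hH
    refine (mul_le_mul hH' h1 (norm_nonneg _) zero_le_one).trans ?_
    rw [one_mul]
    refine le_mul_of_one_le_right hNn.le ?_
    exact one_le_mul_of_one_le_of_one_le (by linarith) hp
  · rw [← Finset.sum_filter_add_sum_filter_not Finset.univ (fun x => ∃ k, AffineOnCoset p f k x),
      sum_affineOnCoset_eq_zero, zero_add]
    have hcard := card_not_affineOnCoset_le (p := p) d α Q hQ hd hH le_rfl
    calc _ ≤ (H : ℝ) * _ := mul_le_mul_of_nonneg_left (hnorm _) H.coe_nonneg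
      _ = _ := mul_comm _ _
      _ ≤ _ := hcard
      _ = ((p ^ α : ℕ) : ℝ) ^ n * ((((d + 1) ^ n * n * (2 * d ^ 2) : ℕ) : ℝ) * p) := by ring
      _ ≤ _ := by
        gcongr
        linarith
end

section
/- Let p be a prime and let P ∈ ℚ_p[X]. Then there exist a, b ∈ ℚ_p such that p^{-1} < max(1, J_P) · μ({z ∈ ℤ_p : |P(z) − a − b·z| ≤ 1}); moreover, if J_P is an integer power of p, then there exist a, b ∈ ℚ_p such that 1 ≤ max(1, J_P) · μ({z ∈ ℤ_p : |P(z) − a − b·z| ≤ 1}). -/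
open Polynomial MeasureTheory
open scoped ENNReal NNReal

noncomputable instance padicIntMeasurableSpace {p : ℕ} [Fact p.Prime] :
    MeasurableSpace ℤ_[p] := borel _

instance padicIntBorelSpace {p : ℕ} [Fact p.Prime] : BorelSpace ℤ_[p] := ⟨rfl⟩

/-- `J_P(z) = max_{2 ≤ k ≤ deg P} |P^{(k)}(z)/k!|^{1/k}` (empty max = 0). -/
noncomputable def Jfun {p : ℕ} [Fact p.Prime] (P : Polynomial ℚ_[p]) (z : ℤ_[p]) : NNReal :=
  (Finset.Icc 2 P.natDegree).sup fun k =>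
    ‖(derivative^[k] P).eval (z : ℚ_[p]) / (k.factorial : ℚ_[p])‖₊ ^ ((1 : ℝ) / (k : ℝ))

/-- `J_P = inf_{z ∈ ℤ_p} J_P(z)`. -/
noncomputable def Jinf {p : ℕ} [Fact p.Prime] (P : Polynomial ℚ_[p]) : NNReal :=
  ⨅ z : ℤ_[p], Jfun P z

theorem continuous_Jfun {p : ℕ} [Fact p.Prime] (P : Polynomial ℚ_[p]) :
    Continuous (Jfun P) := by
  unfold Jfun
  refine Continuous.finset_sup_apply fun k _ => ?_
  refine (NNReal.continuous_rpow_const (by positivity)).comp (Continuous.nnnorm ?_)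
  exact ((Polynomial.continuous _).comp continuous_subtype_val).div_const _

theorem exists_Jfun_eq_Jinf {p : ℕ} [Fact p.Prime] (P : Polynomial ℚ_[p]) :
    ∃ z, Jfun P z = Jinf P := by
  obtain ⟨z, -, hz⟩ := isCompact_univ.exists_isMinOn Set.univ_nonempty
    (continuous_Jfun P).continuousOn
  exact ⟨z, le_antisymm (le_ciInf fun y => hz (Set.mem_univ y)) (ciInf_le (OrderBot.bddBelow _) z)⟩

theorem nnnorm_coeff_taylor_le {p : ℕ} [Fact p.Prime] (P : Polynomial ℚ_[p]) (z : ℤ_[p])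
    {k : ℕ} (hk : 2 ≤ k) : ‖(taylor (z : ℚ_[p]) P).coeff k‖₊ ≤ Jfun P z ^ k := by
  rcases lt_or_ge P.natDegree k with h | h
  · rw [coeff_eq_zero_of_natDegree_lt (by rwa [natDegree_taylor])]
    simp
  · have hcoeff : (taylor (z : ℚ_[p]) P).coeff k =
        (derivative^[k] P).eval (z : ℚ_[p]) / (k.factorial : ℚ_[p]) := by
      rw [taylor_coeff, eq_div_iff (by exact_mod_cast k.factorial_ne_zero),
        ← factorial_smul_hasseDeriv]
      simp [mul_comm]
    have hle := Finset.le_sup (f := fun k : ℕ =>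
      ‖(derivative^[k] P).eval (z : ℚ_[p]) / (k.factorial : ℚ_[p])‖₊ ^ ((1 : ℝ) / (k : ℝ)))
      (Finset.mem_Icc.mpr ⟨hk, h⟩)
    change _ ≤ Jfun P z at hle
    rw [← hcoeff] at hle
    calc _ = (‖(taylor (z : ℚ_[p]) P).coeff k‖₊ ^ ((1 : ℝ) / (k : ℝ))) ^ k := by
          rw [one_div, NNReal.rpow_inv_natCast_pow _ (by omega)]
      _ ≤ _ := pow_le_pow_left₀ zero_le hle k

theorem exists_norm_eval_sub_affine_le_one {p : ℕ} [Fact p.Prime] (P : Polynomial ℚ_[p])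
    (z₀ : ℤ_[p]) : ∃ a b : ℚ_[p], ∀ z : ℤ_[p], Jfun P z₀ * ‖z - z₀‖₊ ≤ 1 →
      ‖P.eval (z : ℚ_[p]) - a - b * (z : ℚ_[p])‖ ≤ 1 := by
  set Q := taylor (z₀ : ℚ_[p]) P with hQ
  refine ⟨Q.coeff 0 - Q.coeff 1 * z₀, Q.coeff 1, fun z hz => ?_⟩
  have heval : P.eval (z : ℚ_[p]) = Q.eval ((z : ℚ_[p]) - z₀) := by
    rw [hQ, taylor_eval]
    simp
  have hsum : P.eval (z : ℚ_[p]) - (Q.coeff 0 - Q.coeff 1 * z₀) - Q.coeff 1 * (z : ℚ_[p]) =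
      ∑ i ∈ Finset.range Q.natDegree, Q.coeff (i + 2) * ((z : ℚ_[p]) - z₀) ^ (i + 2) := by
    rw [heval, eval_eq_sum_range' (show Q.natDegree < Q.natDegree + 2 by omega),
      Finset.sum_range_succ', Finset.sum_range_succ']
    ring
  rw [hsum]
  refine IsUltrametricDist.norm_sum_le_of_forall_le_of_nonneg zero_le_one fun i _ => ?_
  have hnorm : ‖(z : ℚ_[p]) - z₀‖₊ = ‖z - z₀‖₊ := rfl
  rw [← coe_nnnorm, nnnorm_mul, nnnorm_pow, hnorm]
  have := calc
    _ ≤ Jfun P z₀ ^ (i + 2) * ‖z - z₀‖₊ ^ (i + 2) :=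
      mul_le_mul_left (nnnorm_coeff_taylor_le P z₀ (Nat.le_add_left 2 i)) _
    _ = (Jfun P z₀ * ‖z - z₀‖₊) ^ (i + 2) := (mul_pow _ _ _).symm
    _ ≤ 1 := pow_le_one₀ zero_le hz
  exact_mod_cast this

theorem inv_pow_le_measure_ball {p : ℕ} [Fact p.Prime] (μ : Measure ℤ_[p])
    [μ.IsAddHaarMeasure] [IsProbabilityMeasure μ] (z₀ : ℤ_[p]) (n : ℕ) :
    ((p : ℝ≥0∞) ^ n)⁻¹ ≤ μ {z | ‖z - z₀‖ ≤ (p : ℝ) ^ (-n : ℤ)} := by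
  set B := {z : ℤ_[p] | ‖z - z₀‖ ≤ (p : ℝ) ^ (-n : ℤ)}
  have hcover : (Set.univ : Set ℤ_[p]) ⊆
      ⋃ i ∈ Finset.range (p ^ n), (fun z => (z₀ - (i : ℤ_[p])) + z) ⁻¹' B := by
    intro x _
    simp only [Set.mem_iUnion]
    refine ⟨x.appr n, Finset.mem_range.mpr (x.appr_lt n), ?_⟩
    have := (PadicInt.norm_le_pow_iff_mem_span_pow _ n).mpr (PadicInt.appr_spec n x)
    change ‖(z₀ - _) + x - z₀‖ ≤ _
    convert this using 2
    ring
  have hle : 1 ≤ (p : ℝ≥0∞) ^ n * μ B :=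
    calc (1 : ℝ≥0∞) = μ Set.univ := measure_univ.symm
      _ ≤ _ := measure_mono hcover
      _ ≤ _ := measure_biUnion_finset_le _ _
      _ = _ := by simp [measure_preimage_add]
  exact ENNReal.inv_le_iff_le_mul (by simp) (by simp) |>.mpr hle

theorem exists_inv_pow_le_measure_sublevel {p : ℕ} [Fact p.Prime] (P : Polynomial ℚ_[p])
    (μ : Measure ℤ_[p]) [μ.IsAddHaarMeasure] [IsProbabilityMeasure μ] {n : ℕ}
    (hn : Jinf P ≤ (p : ℝ≥0) ^ n) : ∃ a b : ℚ_[p], ((p : ℝ≥0∞) ^ n)⁻¹ ≤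
      μ {z : ℤ_[p] | ‖P.eval (z : ℚ_[p]) - a - b * (z : ℚ_[p])‖ ≤ 1} := by
  obtain ⟨z₀, hz₀⟩ := exists_Jfun_eq_Jinf P
  obtain ⟨a, b, h⟩ := exists_norm_eval_sub_affine_le_one P z₀
  refine ⟨a, b, (inv_pow_le_measure_ball μ z₀ n).trans (measure_mono fun z hz => h z ?_)⟩
  have hp : (p : ℝ≥0) ^ n ≠ 0 := by simp [(Fact.out : p.Prime).ne_zero]
  have hz' : ‖z - z₀‖₊ ≤ ((p : ℝ≥0) ^ n)⁻¹ := by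
    have : ‖z - z₀‖ ≤ (p : ℝ) ^ (-n : ℤ) := hz
    rw [zpow_neg, zpow_natCast] at this
    exact_mod_cast this
  rw [hz₀]
  calc _ ≤ (p : ℝ≥0) ^ n * ((p : ℝ≥0) ^ n)⁻¹ := mul_le_mul' hn hz'
    _ = 1 := mul_inv_cancel₀ hp

/-- Sharpness of the `J`-bound via sublevel sets: for the Haar probability measure `μ` on
`ℤ_p`, there exist `a, b ∈ ℚ_p` with
`p^{-1} < max(1, J_P) · μ({z ∈ ℤ_p : |P(z) - a - b·z| ≤ 1})`; moreover if `J_P` is an integer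
power of `p` there are `a, b` with `1 ≤ max(1, J_P) · μ({z : |P(z) - a - b·z| ≤ 1})`. -/
theorem sublevel_lower_bound (p : ℕ) [Fact p.Prime] (P : Polynomial ℚ_[p])
    (μ : Measure ℤ_[p]) [μ.IsAddHaarMeasure] [IsProbabilityMeasure μ] :
    (∃ a b : ℚ_[p],
      ((p : ℝ≥0∞))⁻¹ <
        max 1 ((Jinf P : ℝ≥0∞)) *
          μ {z : ℤ_[p] | ‖P.eval (z : ℚ_[p]) - a - b * (z : ℚ_[p])‖ ≤ 1}) ∧
    ((∃ k : ℤ, ((Jinf P : ℝ)) = (p : ℝ) ^ k) →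
      ∃ a b : ℚ_[p],
        1 ≤
          max 1 ((Jinf P : ℝ≥0∞)) *
            μ {z : ℤ_[p] | ‖P.eval (z : ℚ_[p]) - a - b * (z : ℚ_[p])‖ ≤ 1}) := by
  have hp : 1 < p := (Fact.out : p.Prime).one_lt
  have hp0 : (p : ℝ≥0∞) ≠ 0 := by simp; omega
  have hexact : ∀ n : ℕ, max 1 (Jinf P) = (p : ℝ≥0) ^ n → ∃ a b : ℚ_[p],
      1 ≤ max 1 ((Jinf P : ℝ≥0∞)) *
        μ {z : ℤ_[p] | ‖P.eval (z : ℚ_[p]) - a - b * (z : ℚ_[p])‖ ≤ 1} := by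
    intro n hn
    obtain ⟨a, b, h⟩ := exists_inv_pow_le_measure_sublevel P μ ((le_max_right _ _).trans hn.le)
    refine ⟨a, b, ?_⟩
    have hM : max 1 ((Jinf P : ℝ≥0∞)) = (p : ℝ≥0∞) ^ n := by
      exact_mod_cast congrArg ENNReal.ofNNReal hn
    rw [hM]
    exact (ENNReal.inv_le_iff_le_mul (by simp) (by simp)).mp h
  refine ⟨?_, ?_⟩
  · obtain ⟨n, hn, hn'⟩ := exists_nat_pow_near (le_max_left 1 (Jinf P))
      (show (1 : ℝ≥0) < p by exact_mod_cast hp)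
    rcases hn.eq_or_lt with heq | hlt
    · obtain ⟨a, b, h⟩ := hexact n heq.symm
      refine ⟨a, b, lt_of_lt_of_le ?_ h⟩
      exact ENNReal.inv_lt_one.mpr (by exact_mod_cast hp)
    · obtain ⟨a, b, h⟩ := exists_inv_pow_le_measure_sublevel P μ
        ((le_max_right _ _).trans hn'.le)
      refine ⟨a, b, lt_of_lt_of_le ?_ (mul_le_mul_right h _)⟩
      have hM : (p : ℝ≥0∞) ^ n < max 1 ((Jinf P : ℝ≥0∞)) := by exact_mod_cast hlt
      calc (p : ℝ≥0∞)⁻¹ = (p : ℝ≥0∞) ^ n * ((p : ℝ≥0∞) ^ (n + 1))⁻¹ := by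
            rw [pow_succ, ENNReal.mul_inv (by simp [hp0]) (by simp), ← mul_assoc,
              ENNReal.mul_inv_cancel (by simp [hp0]) (by simp), one_mul]
        _ < _ := ENNReal.mul_lt_mul_left (by simp) (by simp [hp0]) hM
  · rintro ⟨k, hk⟩
    rcases le_total 0 k with h0 | h0
    · lift k to ℕ using h0
      rw [zpow_natCast] at hk
      have hk' : Jinf P = (p : ℝ≥0) ^ k := by exact_mod_cast hk
      refine hexact k ?_
      rw [hk']
      exact max_eq_right (one_le_pow₀ (by exact_mod_cast hp.le))
    · refine hexact 0 ?_
      have hle : (Jinf P : ℝ) ≤ 1 :=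
        hk.trans_le (zpow_le_one_of_nonpos₀ (by exact_mod_cast hp.le) h0)
      rw [pow_zero]
      exact max_eq_left (by exact_mod_cast hle)
end

section
/- Let p be a prime and let P ∈ ℚ_p[X] have degree d ≥ 2. Suppose that in K[X] the derivative factors completely as P'(X) = a · ∏_{ξ∈R} (X − ξ)^{e_ξ}, where R ⊆ K is the finite set of distinct roots of P', each e_ξ ≥ 1, and a is the leading coefficient of P'. Then for every z ∈ ℤ_p there exists a root ξ ∈ R such that for every subset C ⊆ R with ξ ∈ C one has |a · ∏_{η∈R∖C} (ξ − η)^{e_η}|^{1/(S(C)+1)} ≤ H_P(z), where S(C) = Σ_{η∈C} e_η. -/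
open Polynomial

/-- `H_P(z) = max_{1 ≤ k ≤ deg P} |P^{(k)}(z)/k!|^{1/k}` (empty max = 0). -/
noncomputable def Hfun {p : ℕ} [Fact p.Prime] (P : Polynomial ℚ_[p]) (z : ℤ_[p]) : NNReal :=
  (Finset.Icc 1 P.natDegree).sup fun k =>
    ‖(derivative^[k] P).eval (z : ℚ_[p]) / (k.factorial : ℚ_[p])‖₊ ^ ((1 : ℝ) / (k : ℝ))

theorem norm_hasseDeriv_eval_le_Hfun_pow {p : ℕ} [Fact p.Prime] (P : ℚ_[p][X]) (z : ℤ_[p])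
    {k : ℕ} (hk : k ≠ 0) : ‖(hasseDeriv k P).eval (z : ℚ_[p])‖ ≤ (Hfun P z : ℝ) ^ k := by
  by_cases hkP : k ≤ P.natDegree
  · have hsup := Finset.le_sup (f := fun k : ℕ =>
      ‖(derivative^[k] P).eval (z : ℚ_[p]) / (k.factorial : ℚ_[p])‖₊ ^ ((1 : ℝ) / (k : ℝ)))
      (Finset.mem_Icc.2 ⟨Nat.one_le_iff_ne_zero.2 hk, hkP⟩)
    have hfac : (k.factorial : ℚ_[p]) ≠ 0 := Nat.cast_ne_zero.2 k.factorial_ne_zero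
    have hH : (derivative^[k] P).eval (z : ℚ_[p]) / (k.factorial : ℚ_[p]) =
        (hasseDeriv k P).eval (z : ℚ_[p]) := by
      rw [← factorial_smul_hasseDeriv, LinearMap.smul_apply, eval_smul, nsmul_eq_mul,
        mul_div_cancel_left₀ _ hfac]
    simp only [hH] at hsup
    have hpow := pow_le_pow_left₀ zero_le hsup k
    rw [one_div, NNReal.rpow_inv_natCast_pow _ hk] at hpow
    exact_mod_cast hpow
  · rw [hasseDeriv_eq_zero_of_lt_natDegree _ _ (not_le.1 hkP)]
    simp

theorem norm_coeff_taylor_derivative_le_Hfun_pow {p : ℕ} [Fact p.Prime] (P : ℚ_[p][X])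
    (z : ℤ_[p]) (j : ℕ) :
    ‖(taylor (z : ℚ_[p]) (derivative P)).coeff j‖ ≤ (Hfun P z : ℝ) ^ (j + 1) := by
  have hcomp : hasseDeriv j (derivative P) = (j + 1) • hasseDeriv (j + 1) P := by
    have h := congrArg (fun f => f P) (hasseDeriv_comp (R := ℚ_[p]) j 1)
    simpa [hasseDeriv_one', add_mul] using h
  rw [taylor_coeff, hcomp, eval_smul, nsmul_eq_mul, norm_mul]
  refine (mul_le_of_le_one_left (norm_nonneg _) ?_).trans
    (norm_hasseDeriv_eval_le_Hfun_pow P z j.succ_ne_zero)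
  exact_mod_cast Padic.norm_int_le_one (p := p) ((j + 1 : ℕ) : ℤ)

theorem Hfun_pos {p : ℕ} [Fact p.Prime] {P : ℚ_[p][X]} (hP : derivative P ≠ 0) (z : ℤ_[p]) :
    (0 : ℝ) < Hfun P z := by
  have h := norm_coeff_taylor_derivative_le_Hfun_pow P z (derivative P).natDegree
  rw [coeff_taylor_natDegree] at h
  have hpow := (norm_pos_iff.2 (leadingCoeff_ne_zero.2 hP)).trans_le h
  exact (Hfun P z).coe_nonneg.lt_of_ne' ((pow_ne_zero_iff (Nat.succ_ne_zero _)).1 hpow.ne')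

namespace Polynomial

variable {K : Type*} [Field K] {v : AbsoluteValue K ℝ} {c : ℝ}

theorem gaussNorm_C_mul_prod_pow (hna : IsNonarchimedean v) (hc : 0 < c) {ι : Type*}
    (s : Finset ι) (f : ι → K[X]) (e : ι → ℕ) (a : K) :
    (C a * ∏ i ∈ s, f i ^ e i).gaussNorm v c = v a * ∏ i ∈ s, (f i).gaussNorm v c ^ e i := by
  have := gaussNorm_isAbsoluteValue hna hc
  rw [← gaussNorm_C v c a]
  change IsAbsoluteValue.toAbsoluteValue (gaussNorm v c) _ =
    IsAbsoluteValue.toAbsoluteValue (gaussNorm v c) (C a) *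
      ∏ i ∈ s, IsAbsoluteValue.toAbsoluteValue (gaussNorm v c) (f i) ^ e i
  simp only [map_mul, map_prod, map_pow]

theorem le_gaussNorm_X_add_C (v : AbsoluteValue K ℝ) (hc : 0 ≤ c) (b : K) : c ≤ (X + C b).gaussNorm v c := by
  have h := le_gaussNorm v (X + C b) hc 1
  rw [coeff_add, coeff_X_one, coeff_C_of_ne_zero one_ne_zero] at h
  simpa using h

theorem apply_le_gaussNorm_X_add_C (v : AbsoluteValue K ℝ) (hc : 0 ≤ c) (b : K) : v b ≤ (X + C b).gaussNorm v c := by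
  have h := le_gaussNorm v (X + C b) hc 0
  rw [coeff_add, coeff_X_zero, coeff_C_zero] at h
  simpa using h

/-- Each factor of a split polynomial contributes at least its radius and at least its root
to the Gauss norm. -/
theorem mul_prod_mul_pow_le_gaussNorm [DecidableEq K] (hna : IsNonarchimedean v) (hc : 0 < c)
    {R S : Finset K} (hS : S ⊆ R) (e : K → ℕ) (a z : K) :
    v a * (∏ η ∈ R \ S, v (z - η) ^ e η) * c ^ (∑ η ∈ S, e η) ≤
      (taylor z (C a * ∏ η ∈ R, (X - C η) ^ e η)).gaussNorm v c := by
  have htaylor : taylor z (C a * ∏ η ∈ R, (X - C η) ^ e η) =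
      C a * ∏ η ∈ R, (X + C (z - η)) ^ e η := by
    simp [taylor_apply, mul_comp, prod_comp, add_sub_assoc]
  rw [htaylor, gaussNorm_C_mul_prod_pow hna hc, ← Finset.prod_sdiff hS, mul_assoc,
    ← Finset.prod_pow_eq_pow_sum]
  gcongr with η _ η _
  · exact Finset.prod_nonneg fun η _ => pow_nonneg (gaussNorm_nonneg v _ hc.le) _
  · exact apply_le_gaussNorm_X_add_C v hc.le _
  · exact le_gaussNorm_X_add_C v hc.le _

end Polynomial

theorem gaussNorm_taylor_derivative_le_Hfun {p : ℕ} [Fact p.Prime] {P : ℚ_[p][X]}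
    (hP : derivative P ≠ 0) {K : Type*} [Field K] [Algebra ℚ_[p] K] (v : AbsoluteValue K ℝ)
    (hext : ∀ x : ℚ_[p], v (algebraMap ℚ_[p] K x) = ‖x‖) (z : ℤ_[p]) :
    (taylor (algebraMap ℚ_[p] K z) ((derivative P).map (algebraMap ℚ_[p] K))).gaussNorm v
      (Hfun P z : ℝ)⁻¹ ≤ Hfun P z := by
  have hpos := Hfun_pos hP z
  obtain ⟨j, hj⟩ := exists_eq_gaussNorm v (Hfun P z : ℝ)⁻¹
    (taylor (algebraMap ℚ_[p] K z) ((derivative P).map (algebraMap ℚ_[p] K)))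
  rw [hj, ← map_taylor, coeff_map, hext, inv_pow, mul_inv_le_iff₀ (pow_pos hpos j), ← pow_succ']
  exact norm_coeff_taylor_derivative_le_Hfun_pow P z j

/-- The root-cluster inequality (7.1): if `P ∈ ℚ_p[X]` has degree `d ≥ 2` and `P'` factors
completely over a nonarchimedean valued field `K ⊇ ℚ_p` as `P' = a ∏_{ξ∈R} (X-ξ)^{e_ξ}`,
then for every `z ∈ ℤ_p` there is a root `ξ ∈ R` such that for every subset `C ⊆ R`
containing `ξ`, `|a ∏_{η∉C} (ξ-η)^{e_η}|^{1/(S(C)+1)} ≤ H_P(z)`. -/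
theorem root_cluster_H_bound (p : ℕ) [Fact p.Prime] (d : ℕ) (hd : 2 ≤ d)
    (P : Polynomial ℚ_[p]) (hP : P.natDegree = d)
    (K : Type) [Field K] [Algebra ℚ_[p] K] [DecidableEq K] (v : AbsoluteValue K ℝ)
    (hna : ∀ x y : K, v (x + y) ≤ max (v x) (v y))
    (hext : ∀ x : ℚ_[p], v (algebraMap ℚ_[p] K x) = ‖x‖)
    (R : Finset K) (e : K → ℕ) (a : K)
    (he : ∀ ξ ∈ R, 1 ≤ e ξ)
    (ha : a = algebraMap ℚ_[p] K (derivative P).leadingCoeff)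
    (hfact : (derivative P).map (algebraMap ℚ_[p] K) =
      Polynomial.C a * ∏ ξ ∈ R, (Polynomial.X - Polynomial.C ξ) ^ e ξ) :
    ∀ z : ℤ_[p], ∃ ξ ∈ R, ∀ Cs : Finset K, Cs ⊆ R → ξ ∈ Cs →
      (v (a * ∏ η ∈ R \ Cs, (ξ - η) ^ e η)) ^
          ((1 : ℝ) / (((∑ η ∈ Cs, e η : ℕ) : ℝ) + 1)) ≤
        (Hfun P z : ℝ) := by
  intro z
  have hP' : derivative P ≠ 0 := fun h => by
    have := derivative_eq_zero.1 h
    omega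
  have hpos := Hfun_pos hP' z
  have hR : R.Nonempty := by
    rw [Finset.nonempty_iff_ne_empty]
    rintro rfl
    have hdeg := congrArg natDegree hfact
    rw [natDegree_map, natDegree_derivative, hP, Finset.prod_empty, mul_one, natDegree_C] at hdeg
    omega
  obtain ⟨ξ, hξ, hmin⟩ := R.exists_min_image (fun η => v (algebraMap ℚ_[p] K z - η)) hR
  refine ⟨ξ, hξ, fun Cs hCs _ => ?_⟩
  have hdist : ∀ η ∈ R, v (ξ - η) ≤ v (algebraMap ℚ_[p] K z - η) := fun η hη => by
    have h := hna (ξ - algebraMap ℚ_[p] K z) (algebraMap ℚ_[p] K z - η)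
    rw [sub_add_sub_cancel, v.map_sub ξ (algebraMap ℚ_[p] K z)] at h
    exact h.trans (max_le (hmin η hη) le_rfl)
  have hgauss := (mul_prod_mul_pow_le_gaussNorm hna (inv_pos.2 hpos) hCs e a
    (algebraMap ℚ_[p] K z)).trans (hfact ▸ gaussNorm_taylor_derivative_le_Hfun hP' v hext z)
  rw [inv_pow, mul_inv_le_iff₀ (pow_pos hpos _), ← pow_succ'] at hgauss
  have hle : v (a * ∏ η ∈ R \ Cs, (ξ - η) ^ e η) ≤ (Hfun P z : ℝ) ^ (∑ η ∈ Cs, e η + 1) := by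
    refine le_trans ?_ hgauss
    rw [map_mul, map_prod]
    simp only [map_pow]
    gcongr with η hη
    exact hdist η (Finset.mem_sdiff.1 hη).1
  rw [one_div, ← Nat.cast_add_one]
  calc _ ≤ ((Hfun P z : ℝ) ^ (∑ η ∈ Cs, e η + 1)) ^ (((∑ η ∈ Cs, e η + 1 : ℕ) : ℝ)⁻¹) := by
        gcongr
    _ = Hfun P z := Real.pow_rpow_inv_natCast hpos.le (Nat.succ_ne_zero _)
end

section
/- For every integer d ≥ 1 there exists a constant C_d > 0, depending only on d, such that for every prime p, every polynomial Q ∈ ℚ_p[X] of degree d, and all integers L ≥ 1 and k ≥ 1, μ({z ∈ ℤ_p : |Q(z)| ≤ p^{-L} and |Q^{(k)}(z)/k!| ≥ 1}) ≤ C_d · p^{-L/k}, where μ is the Haar probability measure on ℤ_p. -/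
open Polynomial MeasureTheory
open scoped ENNReal NNReal

/-- If `z` has distance at least `r` from every element of the multiset `s`, the Taylor coefficients
of `∏ (X - a)` at `z` are controlled by its value at `z`. -/
lemma norm_taylor_coeff_prod_X_sub_C_mul_pow_le {K : Type*} [NormedField K] [IsUltrametricDist K]
    (z : K) {r : ℝ} (hr : 0 ≤ r) (s : Multiset K) (hs : ∀ a ∈ s, r ≤ ‖z - a‖) (k : ℕ) :
    ‖(taylor z (s.map fun a => X - C a).prod).coeff k‖ * r ^ k ≤
      ‖(s.map fun a => X - C a).prod.eval z‖ := by
  induction s using Multiset.induction_on generalizing k with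
  | empty =>
    rcases k with _ | k
    · simp
    · simp [coeff_one]
  | cons a s ih =>
    have ha : r ≤ ‖z - a‖ := hs a (Multiset.mem_cons_self a s)
    have ih' := ih fun b hb => hs b (Multiset.mem_cons_of_mem hb)
    simp only [Multiset.map_cons, Multiset.prod_cons, taylor_mul, eval_mul, norm_mul]
    set P := (s.map fun a => X - C a).prod
    have hX : taylor z (X - C a) = X + C (z - a) := by
      simp only [map_sub, taylor_X, taylor_C]
      ring
    have hE : ‖(X - C a).eval z‖ = ‖z - a‖ := by simp
    rw [hX, hE, add_mul, coeff_add, coeff_C_mul]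
    rcases k with _ | k
    · simp
    · rw [coeff_X_mul]
      calc _ ≤ max ‖(taylor z P).coeff k‖ ‖(z - a) * (taylor z P).coeff (k + 1)‖ * r ^ (k + 1) := by
            gcongr
            exact IsUltrametricDist.norm_add_le_max _ _
        _ ≤ ‖z - a‖ * ‖P.eval z‖ := by
            rw [max_mul_of_nonneg _ _ (by positivity)]
            refine max_le ?_ ?_
            · calc _ = r * (‖(taylor z P).coeff k‖ * r ^ k) := by ring
                _ ≤ _ := by gcongr; exact ih' k
            · rw [norm_mul, mul_assoc]
              gcongr
              exact ih' (k + 1)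

/-- Over an ultrametric field, a split polynomial has a root whose distance to `z` is controlled by
the value and any Taylor coefficient of the polynomial at `z`. -/
lemma exists_root_norm_taylor_coeff_mul_pow_le {K : Type*} [NormedField K]
    [IsUltrametricDist K] {f : K[X]} (hf : f.Splits) (hf0 : f.natDegree ≠ 0) (z : K) (k : ℕ) :
    ∃ a ∈ f.roots, ‖(taylor z f).coeff k‖ * ‖z - a‖ ^ k ≤ ‖f.eval z‖ := by
  classical
  obtain ⟨b, hb⟩ := Multiset.exists_mem_of_ne_zero (hf.roots_ne_zero hf0)
  obtain ⟨a, ha, hmin⟩ := f.roots.toFinset.exists_min_image (fun a => ‖z - a‖)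
    ⟨b, Multiset.mem_toFinset.2 hb⟩
  refine ⟨a, Multiset.mem_toFinset.1 ha, ?_⟩
  have h := norm_taylor_coeff_prod_X_sub_C_mul_pow_le z (norm_nonneg (z - a)) f.roots
    (fun b hb => hmin b (Multiset.mem_toFinset.2 hb)) k
  rw [hf.eq_prod_roots, taylor_mul, taylor_C, coeff_C_mul, eval_mul, eval_C, norm_mul, norm_mul,
    mul_assoc]
  gcongr

namespace PadicInt

variable {p : ℕ} [Fact p.Prime] (μ : Measure ℤ_[p]) [μ.IsAddHaarMeasure] [IsProbabilityMeasure μ]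

lemma measure_span_pow (n : ℕ) :
    μ (Ideal.span {(p : ℤ_[p]) ^ n} : Ideal ℤ_[p]) = ((p : ℝ≥0∞) ^ n)⁻¹ := by
  have hp : p ≠ 0 := (Fact.out : p.Prime).ne_zero
  let H : AddSubgroup ℤ_[p] := (Ideal.span {(p : ℤ_[p]) ^ n} : Ideal ℤ_[p]).toAddSubgroup
  have hH : H = (toZModPow (p := p) n).toAddMonoidHom.ker := by
    ext x
    change x ∈ Ideal.span {(p : ℤ_[p]) ^ n} ↔ x ∈ RingHom.ker (toZModPow (p := p) n)
    rw [ker_toZModPow]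
  have hindex : H.index = p ^ n := by
    rw [hH, AddSubgroup.index_ker, AddMonoidHom.range_eq_top.2, AddSubgroup.card_top, Nat.card_zmod]
    exact ZMod.ringHom_surjective (toZModPow (p := p) n)
  have : H.FiniteIndex := ⟨by rw [hindex]; exact pow_ne_zero n hp⟩
  have hset : (H : Set ℤ_[p]) = Metric.closedBall 0 ((p : ℝ) ^ (-n : ℤ)) := by
    ext x
    rw [mem_closedBall_zero_iff, norm_le_pow_iff_mem_span_pow]
    rfl
  have h := AddSubgroup.index_mul_measure H (hset ▸ Metric.isClosed_closedBall.measurableSet) μ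
  rw [hindex, measure_univ, Nat.cast_pow] at h
  exact ENNReal.eq_inv_of_mul_eq_one_left (by rwa [mul_comm] at h)

lemma measure_closedBall_le (z : ℤ_[p]) {r : ℝ} (hr0 : 0 < r) (hr1 : r ≤ 1) :
    μ (Metric.closedBall z r) ≤ ENNReal.ofReal r := by
  have hp : 1 < (p : ℝ) := mod_cast (Fact.out : p.Prime).one_lt
  obtain ⟨m, hm1, hm2⟩ := exists_mem_Ico_zpow hr0 hp
  have hm : m ≤ 0 := by
    by_contra! h
    exact absurd (hm1.trans hr1) (not_le.2 (one_lt_zpow₀ hp h))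
  obtain ⟨n, rfl⟩ : ∃ n : ℕ, m = -n := ⟨m.natAbs, by omega⟩
  have hsub : Metric.closedBall z r ⊆
      (fun x => -z + x) ⁻¹' (Ideal.span {(p : ℤ_[p]) ^ n} : Ideal ℤ_[p]) := by
    intro x hx
    rw [mem_closedBall_iff_norm] at hx
    rw [Set.mem_preimage, SetLike.mem_coe, ← norm_le_pow_iff_mem_span_pow,
      norm_le_pow_iff_norm_lt_pow_add_one, neg_add_eq_sub]
    exact hx.trans_lt hm2
  calc μ (Metric.closedBall z r) ≤ ((p : ℝ≥0∞) ^ n)⁻¹ := by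
        rw [← measure_span_pow μ,
          ← measure_preimage_add μ (-z) (Ideal.span {(p : ℤ_[p]) ^ n} : Ideal ℤ_[p])]
        exact measure_mono hsub
    _ = ENNReal.ofReal ((p : ℝ) ^ (-n : ℤ)) := by
        rw [zpow_neg, zpow_natCast, ENNReal.ofReal_inv_of_pos (by positivity),
          ENNReal.ofReal_pow (by positivity), ENNReal.ofReal_natCast]
    _ ≤ ENNReal.ofReal r := ENNReal.ofReal_le_ofReal hm1

/-- The trace on `ℤ_[p]` of a ball of `PadicAlgCl p` of radius `r ≤ 1` has measure at most `r`. -/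
lemma measure_norm_algebraMap_sub_le (a : PadicAlgCl p) {r : ℝ} (hr0 : 0 < r) (hr1 : r ≤ 1) :
    μ {z : ℤ_[p] | ‖algebraMap ℚ_[p] (PadicAlgCl p) z - a‖ ≤ r} ≤ ENNReal.ofReal r := by
  rcases Set.eq_empty_or_nonempty {z : ℤ_[p] | ‖algebraMap ℚ_[p] (PadicAlgCl p) z - a‖ ≤ r} with
    h | ⟨z, hz⟩
  · simp [h]
  · refine (measure_mono fun w hw => ?_).trans (measure_closedBall_le μ z hr0 hr1)
    rw [mem_closedBall_iff_norm, norm_def, coe_sub, ← PadicAlgCl.norm_extends, map_sub,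
      ← sub_add_sub_cancel _ a]
    exact (IsUltrametricDist.norm_add_le_max _ _).trans (max_le hw (norm_sub_rev _ a ▸ hz))

end PadicInt

/-- Corollary 8.2, measure estimate: for every `d ≥ 1` there is `C_d > 0` such that for every
prime `p`, every `Q ∈ ℚ_p[X]` of degree `d` and all `L, k ≥ 1`,
`μ({z ∈ ℤ_p : |Q(z)| ≤ p^{-L}, |Q^{(k)}(z)/k!| ≥ 1}) ≤ C_d · p^{-L/k}` for the Haar
probability measure `μ` on `ℤ_p`. -/
theorem sublevel_measure_bound (d : ℕ) (hd : 1 ≤ d) :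
    ∃ C : ℝ, 0 < C ∧
      ∀ (p : ℕ) [Fact p.Prime],
        ∀ Q : Polynomial ℚ_[p], Q.natDegree = d →
          ∀ L k : ℕ, 1 ≤ L → 1 ≤ k →
            ∀ (μ : Measure ℤ_[p]) [μ.IsAddHaarMeasure] [IsProbabilityMeasure μ],
              μ {z : ℤ_[p] |
                  ‖Q.eval (z : ℚ_[p])‖ ≤ (p : ℝ) ^ (-(L : ℤ)) ∧
                  1 ≤ ‖(derivative^[k] Q).eval (z : ℚ_[p]) / (k.factorial : ℚ_[p])‖} ≤
                ENNReal.ofReal (C * (p : ℝ) ^ (-(L : ℝ) / (k : ℝ))) := by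
  refine ⟨d, by exact_mod_cast hd, ?_⟩
  intro p _ Q hQ L k hL hk μ _ _
  classical
  have hp : 1 < (p : ℝ) := mod_cast (Fact.out : p.Prime).one_lt
  have hk0 : (k : ℝ) ≠ 0 := by positivity
  set r : ℝ := (p : ℝ) ^ (-(L : ℝ) / (k : ℝ)) with hr
  have hr0 : 0 < r := by positivity
  have hr1 : r ≤ 1 := Real.rpow_le_one_of_one_le_of_nonpos hp.le
    (div_nonpos_of_nonpos_of_nonneg (by simp) (by positivity))
  have hrk : r ^ k = (p : ℝ) ^ (-(L : ℤ)) := by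
    rw [hr, ← Real.rpow_mul_natCast (by positivity), div_mul_cancel₀ _ hk0, ← Real.rpow_intCast]
    simp
  let φ := algebraMap ℚ_[p] (PadicAlgCl p)
  let f := Q.map φ
  have hf : f.Splits := IsAlgClosed.splits f
  have hfd : f.natDegree = d := by rw [natDegree_map, hQ]
  have hcover : {z : ℤ_[p] | ‖Q.eval (z : ℚ_[p])‖ ≤ (p : ℝ) ^ (-(L : ℤ)) ∧
      1 ≤ ‖(derivative^[k] Q).eval (z : ℚ_[p]) / (k.factorial : ℚ_[p])‖} ⊆
      ⋃ a ∈ f.roots.toFinset, {z : ℤ_[p] | ‖φ z - a‖ ≤ r} := by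
    rintro z ⟨hz, hzk⟩
    obtain ⟨a, ha, h⟩ := exists_root_norm_taylor_coeff_mul_pow_le hf (by omega) (φ z) k
    have hcoeff : ‖(taylor (φ z) f).coeff k‖ =
        ‖(derivative^[k] Q).eval (z : ℚ_[p]) / (k.factorial : ℚ_[p])‖ := by
      have hfac : (k.factorial : ℚ_[p]) ≠ 0 := mod_cast k.factorial_ne_zero
      rw [← factorial_smul_hasseDeriv, LinearMap.smul_apply, eval_smul, nsmul_eq_mul,
        mul_div_cancel_left₀ _ hfac, ← taylor_coeff, ← PadicAlgCl.norm_extends p, ← coeff_map,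
        map_taylor]
    have heval : ‖f.eval (φ z)‖ = ‖Q.eval (z : ℚ_[p])‖ := by
      rw [eval_map_apply, PadicAlgCl.norm_extends]
    rw [hcoeff, heval] at h
    simp only [Set.mem_iUnion]
    refine ⟨a, Multiset.mem_toFinset.2 ha, ?_⟩
    refine le_of_pow_le_pow_left₀ (by omega : k ≠ 0) hr0.le ?_
    rw [hrk]
    exact (le_mul_of_one_le_left (by positivity) hzk).trans (h.trans hz)
  calc _ ≤ ∑ a ∈ f.roots.toFinset, μ {z : ℤ_[p] | ‖φ z - a‖ ≤ r} :=
        (measure_mono hcover).trans (measure_biUnion_finset_le _ _)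
    _ ≤ f.roots.toFinset.card • ENNReal.ofReal r :=
        Finset.sum_le_card_nsmul _ _ _ fun a _ =>
          PadicInt.measure_norm_algebraMap_sub_le μ a hr0 hr1
    _ ≤ d • ENNReal.ofReal r := by
        gcongr
        exact (Multiset.toFinset_card_le _).trans (hfd ▸ card_roots' f)
    _ = ENNReal.ofReal (d * r) := by
        rw [nsmul_eq_mul, ENNReal.ofReal_mul (by positivity), ENNReal.ofReal_natCast]
end

section
/- For every integer d ≥ 1 there exists a constant C_d > 0, depending only on d, such that for every prime p, every polynomial P ∈ ℚ_p[X] of degree d, every integer k ≥ 1, and all integers n, m ∈ ℤ, μ({z ∈ ℤ_p : |P(z)| ≤ p^{m} and |P^{(k)}(z)/k!| ≥ p^{n}}) ≤ C_d · p^{(m−n)/k}, where μ is the Haar probability measure on ℤ_p. -/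
open Polynomial MeasureTheory
open scoped ENNReal NNReal

/-- If every root `-β` of a monic split polynomial over an ultrametric field has norm greater than
`r`, then the coefficients decay geometrically with ratio `r⁻¹` relative to the constant one. -/
lemma coeff_prod_X_add_C_lt {K : Type*} [NormedField K] [IsUltrametricDist K] {r : ℝ} (hr : 0 < r)
    (s : Multiset K) (hs : ∀ β ∈ s, r < ‖β‖) :
    0 < ‖((s.map fun β => X + C β).prod).coeff 0‖ ∧
      ∀ k : ℕ, 1 ≤ k → ‖((s.map fun β => X + C β).prod).coeff k‖ * r ^ k <
        ‖((s.map fun β => X + C β).prod).coeff 0‖ := by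
  induction s using Multiset.induction_on with
  | empty =>
    refine ⟨by simp, fun k hk => ?_⟩
    have : k ≠ 0 := by omega
    simp [coeff_one, this]
  | cons β s ih =>
    obtain ⟨h0, ih⟩ := ih fun b hb => hs b (Multiset.mem_cons_of_mem hb)
    have hβ := hs β (Multiset.mem_cons_self β s)
    have hβ0 : 0 < ‖β‖ := hr.trans hβ
    simp only [Multiset.map_cons, Multiset.prod_cons]
    set Q := (s.map fun β => X + C β).prod
    have hc0 : ‖((X + C β) * Q).coeff 0‖ = ‖β‖ * ‖Q.coeff 0‖ := by simp [mul_coeff_zero]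
    refine ⟨by rw [hc0]; positivity, fun k hk => ?_⟩
    obtain ⟨k, rfl⟩ : ∃ j, k = j + 1 := ⟨k - 1, by omega⟩
    have hck : ((X + C β) * Q).coeff (k + 1) = Q.coeff k + β * Q.coeff (k + 1) := by
      simp [add_mul]
    rw [hc0, hck]
    have h1 : ‖Q.coeff k‖ * r ^ (k + 1) < ‖β‖ * ‖Q.coeff 0‖ := by
      have hle : ‖Q.coeff k‖ * r ^ k ≤ ‖Q.coeff 0‖ := by
        rcases Nat.eq_zero_or_pos k with rfl | hk'
        · simp
        · exact (ih k hk').le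
      calc ‖Q.coeff k‖ * r ^ (k + 1) = r * (‖Q.coeff k‖ * r ^ k) := by ring
        _ ≤ r * ‖Q.coeff 0‖ := by gcongr
        _ < ‖β‖ * ‖Q.coeff 0‖ := by gcongr
    have h2 : ‖β * Q.coeff (k + 1)‖ * r ^ (k + 1) < ‖β‖ * ‖Q.coeff 0‖ := by
      rw [norm_mul, mul_assoc]
      exact mul_lt_mul_of_pos_left (ih (k + 1) (by omega)) hβ0
    rcases le_max_iff.mp (IsUltrametricDist.norm_add_le_max (Q.coeff k) (β * Q.coeff (k + 1)))
      with h | h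
    · exact (mul_le_mul_of_nonneg_right h (by positivity)).trans_lt h1
    · exact (mul_le_mul_of_nonneg_right h (by positivity)).trans_lt h2

/-- A split polynomial over an ultrametric field whose `k`-th Hasse derivative at `z` is at least
`‖f z‖ / r ^ k` has a root at distance at most `r` from `z`. -/
lemma exists_root_norm_sub_le {K : Type*} [NormedField K] [IsUltrametricDist K] {r : ℝ}
    (hr : 0 < r) {f : K[X]} (hf : f.Splits) (hf0 : f ≠ 0) {k : ℕ} (hk : 1 ≤ k) (z : K)
    (h : ‖f.eval z‖ ≤ ‖(hasseDeriv k f).eval z‖ * r ^ k) :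
    ∃ α ∈ f.roots, ‖z - α‖ ≤ r := by
  by_contra! hroots
  have hT : taylor z f =
      C f.leadingCoeff * ((f.roots.map fun α => z - α).map fun β => X + C β).prod := by
    conv_lhs => rw [hf.eq_prod_roots]
    rw [taylor_mul, taylor_C, taylor_apply, multiset_prod_comp, Multiset.map_map, Multiset.map_map]
    congr 3
    ext1 α
    simp [add_sub_assoc]
  obtain ⟨-, hlt⟩ := coeff_prod_X_add_C_lt hr (f.roots.map fun α => z - α) (by
    intro β hβ
    obtain ⟨α, hα, rfl⟩ := Multiset.mem_map.mp hβ
    exact hroots α hα)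
  have hlt := hlt k hk
  rw [← taylor_coeff, ← taylor_coeff_zero, hT, coeff_C_mul, coeff_C_mul, norm_mul, norm_mul,
    mul_assoc] at h
  exact absurd (le_of_mul_le_mul_left h (by simpa using hf0)) hlt.not_ge

lemma hasseDeriv_eval_eq_iterate_derivative_div {K : Type*} [Field K] [CharZero K] (f : K[X])
    (k : ℕ) (z : K) :
    (hasseDeriv k f).eval z = (derivative^[k] f).eval z / (k.factorial : K) := by
  rw [← factorial_smul_hasseDeriv, eq_div_iff (by exact_mod_cast k.factorial_ne_zero)]
  simp [mul_comm]

lemma hasseDeriv_map {R S : Type*} [Semiring R] [Semiring S] (φ : R →+* S) (f : R[X]) (k : ℕ) :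
    hasseDeriv k (f.map φ) = (hasseDeriv k f).map φ := by
  ext n
  simp [hasseDeriv_coeff]

lemma padicInt_measure_closedBall_pow_le {p : ℕ} [Fact p.Prime] (μ : Measure ℤ_[p])
    [μ.IsAddHaarMeasure] [IsProbabilityMeasure μ] (a : ℤ_[p]) (N : ℕ) :
    μ (Metric.closedBall a ((p : ℝ) ^ (-N : ℤ))) ≤ ((p : ℝ≥0∞) ^ N)⁻¹ := by
  have hdisj : (Finset.range (p ^ N) : Set ℕ).PairwiseDisjoint
      fun i : ℕ => Metric.closedBall (i : ℤ_[p]) ((p : ℝ) ^ (-N : ℤ)) := by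
    intro i hi j hj hij
    refine Set.disjoint_left.mpr fun x hxi hxj => hij ?_
    rw [Metric.mem_closedBall] at hxi hxj
    have hd : ‖(((i : ℤ) - (j : ℤ) : ℤ) : ℤ_[p])‖ ≤ (p : ℝ) ^ (-N : ℤ) := by
      push_cast
      rw [← dist_eq_norm]
      exact (dist_triangle_max _ x _).trans (max_le (by rwa [dist_comm]) hxj)
    rw [PadicInt.norm_int_le_pow_iff_dvd] at hd
    have hmod : j ≡ i [MOD p ^ N] := (Nat.modEq_iff_dvd).mpr (by exact_mod_cast hd)
    simp only [Finset.coe_range, Set.mem_Iio] at hi hj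
    exact (hmod.eq_of_lt_of_lt hj hi).symm
  have hsum := measure_biUnion_finset (μ := μ) hdisj
    fun i _ => Metric.isClosed_closedBall.measurableSet
  have hball (b : ℤ_[p]) : μ (Metric.closedBall b ((p : ℝ) ^ (-N : ℤ))) =
      μ (Metric.closedBall 0 ((p : ℝ) ^ (-N : ℤ))) := Measure.addHaar_closedBall_center μ b _
  simp only [hball, Finset.sum_const, Finset.card_range, nsmul_eq_mul] at hsum
  rw [hball, ENNReal.le_inv_iff_mul_le, mul_comm]
  calc _ = _ := by rw [hsum]; push_cast; rfl
    _ ≤ 1 := prob_le_one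

lemma padicInt_measure_closedBall_le {p : ℕ} [hp : Fact p.Prime] (μ : Measure ℤ_[p])
    [μ.IsAddHaarMeasure] [IsProbabilityMeasure μ] (a : ℤ_[p]) {r : ℝ} (hr : 0 < r) :
    μ (Metric.closedBall a r) ≤ ENNReal.ofReal r := by
  rcases le_or_gt 1 r with h1 | h1
  · exact prob_le_one.trans (by simpa using h1)
  have hp1 : (1 : ℝ) < p := by exact_mod_cast hp.out.one_lt
  have hp0 : (0 : ℝ) < p := by positivity
  obtain ⟨N, hN, hN'⟩ := exists_mem_Ico_zpow hr hp1
  obtain ⟨M, rfl⟩ : ∃ M : ℕ, N = -M := by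
    refine ⟨(-N).toNat, ?_⟩
    have : (p : ℝ) ^ N < (p : ℝ) ^ (0 : ℤ) := by simpa using hN.trans_lt h1
    have := (zpow_lt_zpow_iff_right₀ hp1).mp this
    omega
  have hsub : Metric.closedBall a r ⊆ Metric.closedBall a ((p : ℝ) ^ (-M : ℤ)) := by
    intro x hx
    rw [Metric.mem_closedBall, dist_eq_norm] at hx ⊢
    exact (PadicInt.norm_le_pow_iff_norm_lt_pow_add_one _ _).mpr (hx.trans_lt hN')
  refine (measure_mono hsub).trans ((padicInt_measure_closedBall_pow_le μ a M).trans ?_)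
  rw [← ENNReal.ofReal_natCast, ← ENNReal.ofReal_pow hp0.le,
    ← ENNReal.ofReal_inv_of_pos (by positivity)]
  exact ENNReal.ofReal_le_ofReal (by simpa using hN)

lemma padicInt_measure_norm_sub_le {p : ℕ} [Fact p.Prime] (μ : Measure ℤ_[p])
    [μ.IsAddHaarMeasure] [IsProbabilityMeasure μ] (α : PadicAlgCl p) {r : ℝ} (hr : 0 < r) :
    μ {z : ℤ_[p] | ‖algebraMap ℚ_[p] (PadicAlgCl p) z - α‖ ≤ r} ≤ ENNReal.ofReal r := by
  rcases Set.eq_empty_or_nonempty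
    {z : ℤ_[p] | ‖algebraMap ℚ_[p] (PadicAlgCl p) z - α‖ ≤ r} with h | ⟨a, ha⟩
  · simp [h]
  refine (measure_mono fun z hz => ?_).trans (padicInt_measure_closedBall_le μ a hr)
  rw [Set.mem_ofPred_eq, ← dist_eq_norm] at ha hz
  have h := (dist_triangle_max (algebraMap ℚ_[p] (PadicAlgCl p) z) α
    (algebraMap ℚ_[p] (PadicAlgCl p) a)).trans (max_le hz (by rwa [dist_comm]))
  rw [Metric.mem_closedBall, dist_eq_norm, PadicInt.norm_def, PadicInt.coe_sub]
  rwa [dist_eq_norm, ← map_sub, norm_algebraMap'] at h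

/-- The scaled sublevel set estimate (8.4): for every `d ≥ 1` there is `C_d > 0` such that for
every prime `p`, every `P ∈ ℚ_p[X]` of degree `d`, every `k ≥ 1` and all `n, m ∈ ℤ`,
`μ({z ∈ ℤ_p : |P(z)| ≤ p^m, |P^{(k)}(z)/k!| ≥ p^n}) ≤ C_d · p^{(m-n)/k}` for the Haar
probability measure `μ` on `ℤ_p`. -/
theorem sublevel_measure_bound_scaled (d : ℕ) (hd : 1 ≤ d) :
    ∃ C : ℝ, 0 < C ∧
      ∀ (p : ℕ) [Fact p.Prime],
        ∀ P : Polynomial ℚ_[p], P.natDegree = d →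
          ∀ k : ℕ, 1 ≤ k → ∀ n m : ℤ,
            ∀ (μ : Measure ℤ_[p]) [μ.IsAddHaarMeasure] [IsProbabilityMeasure μ],
              μ {z : ℤ_[p] |
                  ‖P.eval (z : ℚ_[p])‖ ≤ (p : ℝ) ^ m ∧
                  (p : ℝ) ^ n ≤ ‖(derivative^[k] P).eval (z : ℚ_[p]) / (k.factorial : ℚ_[p])‖} ≤
                ENNReal.ofReal (C * (p : ℝ) ^ (((m : ℝ) - (n : ℝ)) / (k : ℝ))) := by
  refine ⟨d, by exact_mod_cast hd, ?_⟩
  intro p hp P hP k hk n m μ _ _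
  have hp0 : (0 : ℝ) < p := by exact_mod_cast hp.out.pos
  set r : ℝ := (p : ℝ) ^ (((m : ℝ) - (n : ℝ)) / (k : ℝ)) with hr_def
  have hr : 0 < r := Real.rpow_pos_of_pos hp0 _
  have hrk : (p : ℝ) ^ n * r ^ k = (p : ℝ) ^ m := by
    have hk0 : (k : ℝ) ≠ 0 := by positivity
    rw [hr_def, ← Real.rpow_natCast, ← Real.rpow_mul hp0.le, div_mul_cancel₀ _ hk0,
      ← Real.rpow_intCast, ← Real.rpow_add hp0, add_sub_cancel, Real.rpow_intCast]
  have hP0 : P ≠ 0 := by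
    rintro rfl
    simp at hP
    omega
  set φ := algebraMap ℚ_[p] (PadicAlgCl p)
  set f := P.map φ with hf
  have hf0 : f ≠ 0 := (Polynomial.map_ne_zero_iff φ.injective).mpr hP0
  classical
  have hcard : (f.roots.toFinset.card : ℝ≥0∞) ≤ d := by
    have := f.roots.toFinset_card_le.trans (card_roots' f)
    rw [hf, natDegree_map, hP] at this
    exact_mod_cast this
  calc _ ≤ μ (⋃ α ∈ f.roots.toFinset, {z : ℤ_[p] | ‖φ z - α‖ ≤ r}) := by
        refine measure_mono fun z ⟨hz1, hz2⟩ => ?_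
        obtain ⟨α, hα, hzα⟩ := exists_root_norm_sub_le hr (IsAlgClosed.splits f) hf0 hk (φ z) (by
          rw [hf, hasseDeriv_map, eval_map_apply, eval_map_apply, norm_algebraMap',
            norm_algebraMap', hasseDeriv_eval_eq_iterate_derivative_div]
          calc _ ≤ (p : ℝ) ^ n * r ^ k := hrk ▸ hz1
            _ ≤ _ := by gcongr)
        exact Set.mem_biUnion (by simpa using hα) hzα
    _ ≤ ∑ α ∈ f.roots.toFinset, μ {z : ℤ_[p] | ‖φ z - α‖ ≤ r} := measure_biUnion_finset_le _ _
    _ ≤ ∑ α ∈ f.roots.toFinset, ENNReal.ofReal r :=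
        Finset.sum_le_sum fun α _ => padicInt_measure_norm_sub_le μ α hr
    _ = f.roots.toFinset.card * ENNReal.ofReal r := by simp
    _ ≤ d * ENNReal.ofReal r := by gcongr
    _ = ENNReal.ofReal (d * r) := by
        rw [ENNReal.ofReal_mul (by positivity), ENNReal.ofReal_natCast]
end

section
/- Let p be a prime and L ≥ 1 an integer. Let φ(t) = Σ_{j=0}^{n} c_j t^j ∈ ℚ_p[X], set λ = max_{0≤j≤n} |c_j| and λ₊ = max(λ, 1). Let t₀ ∈ ℤ_p be a point with φ^{(k)}(t₀) ≠ 0 for each 1 ≤ k ≤ L. Set δ = |φ(t₀) · φ'(t₀)^{-1} · (φ^{(L)}(t₀)/L!)^{-1}| and, for 1 ≤ k ≤ L−1, δ_k = |(φ^{(k+1)}(t₀) · φ^{(k)}(t₀)^{-1})/(k+1) · φ(t₀) · φ'(t₀)^{-1}|. Assume: if L = 1, that λ₊·δ < 1; and if L ≥ 2, that λ₊·δ ≤ 1, δ₁ < 1, and δ_k ≤ 1 for all 2 ≤ k ≤ L−1. Then there exists t ∈ ℚ_p such that φ(t) = 0 and |t − t₀| ≤ |φ(t₀) · φ'(t₀)^{-1}|.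 -/
open Polynomial

/-- `λ₊ = max(λ, 1)` where `λ = max_j |c_j|` is the maximum of the absolute values of the
coefficients of `φ`. -/
noncomputable def lamPlus {p : ℕ} [Fact p.Prime] (φ : Polynomial ℚ_[p]) : ℝ :=
  max ((((Finset.range (φ.natDegree + 1)).sup fun j => ‖φ.coeff j‖₊) : NNReal) : ℝ) 1

/-- `δ = |φ(t₀)·φ'(t₀)⁻¹·(φ^{(L)}(t₀)/L!)⁻¹|`. -/
noncomputable def henselDelta {p : ℕ} [Fact p.Prime] (φ : Polynomial ℚ_[p]) (t₀ : ℤ_[p])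
    (L : ℕ) : ℝ :=
  ‖φ.eval (t₀ : ℚ_[p]) * ((derivative φ).eval (t₀ : ℚ_[p]))⁻¹ *
    ((derivative^[L] φ).eval (t₀ : ℚ_[p]) / (L.factorial : ℚ_[p]))⁻¹‖

/-- `δ_k = |(φ^{(k+1)}(t₀)·φ^{(k)}(t₀)⁻¹)/(k+1) · φ(t₀)·φ'(t₀)⁻¹|`. -/
noncomputable def henselDeltaK {p : ℕ} [Fact p.Prime] (φ : Polynomial ℚ_[p]) (t₀ : ℤ_[p])
    (k : ℕ) : ℝ :=
  ‖(derivative^[k + 1] φ).eval (t₀ : ℚ_[p]) * ((derivative^[k] φ).eval (t₀ : ℚ_[p]))⁻¹ /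
      ((k : ℚ_[p]) + 1) *
    (φ.eval (t₀ : ℚ_[p]) * ((derivative φ).eval (t₀ : ℚ_[p]))⁻¹)‖

open IsLocalRing in
/-- **Hensel's lemma with linear reduction.** A `p`-adic polynomial with integral coefficients whose
reduction modulo `p` is linear with non-zero leading coefficient has a root in `ℤ_p`. -/
theorem exists_padicInt_root_of_linear_reduction {p : ℕ} [Fact p.Prime] (G : Polynomial ℚ_[p])
    (h0 : ‖G.coeff 0‖ ≤ 1) (h1 : ‖G.coeff 1‖ = 1) (h2 : ∀ k, 2 ≤ k → ‖G.coeff k‖ < 1) :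
    ∃ s : ℤ_[p], G.eval (s : ℚ_[p]) = 0 := by
  have hint : ∀ k, ‖G.coeff k‖ ≤ 1
    | 0 => h0
    | 1 => h1.le
    | k + 2 => (h2 (k + 2) (by omega)).le
  obtain ⟨F, rfl⟩ : ∃ F : Polynomial ℤ_[p], F.map (algebraMap ℤ_[p] ℚ_[p]) = G := by
    rw [← mem_lifts, lifts_iff_coeff_lifts]
    exact fun k => ⟨⟨G.coeff k, hint k⟩, rfl⟩
  simp only [coeff_map, PadicInt.algebraMap_apply, ← PadicInt.norm_def] at h1 h2
  have hred : F.map (residue ℤ_[p]) =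
      C (residue ℤ_[p] (F.coeff 1)) * X + C (residue ℤ_[p] (F.coeff 0)) := by
    ext k
    match k with
    | 0 => simp
    | 1 => simp
    | k + 2 =>
      have : residue ℤ_[p] (F.coeff (k + 2)) = 0 := by
        rw [residue_eq_zero_iff, mem_maximalIdeal, PadicInt.mem_nonunits]
        exact h2 _ (by omega)
      simp [this]
  have hunit : residue ℤ_[p] (F.coeff 1) ≠ 0 := by
    rwa [residue_ne_zero_iff_isUnit, PadicInt.isUnit_iff]
  obtain ⟨a, ha⟩ := residue_surjective (R := ℤ_[p])
    (-(residue ℤ_[p] (F.coeff 0)) / residue ℤ_[p] (F.coeff 1))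
  have hFa : ‖F.eval a‖ < 1 := by
    rw [← PadicInt.mem_nonunits, ← mem_maximalIdeal, ← residue_eq_zero_iff, ← eval_map_apply, hred,
      ha]
    simp only [eval_add, eval_mul, eval_C, eval_X]
    field_simp
    ring
  have hFa' : ‖F.derivative.eval a‖ = 1 := by
    rw [← PadicInt.isUnit_iff, ← residue_ne_zero_iff_isUnit, ← eval_map_apply, ← derivative_map,
      hred]
    simpa using hunit
  obtain ⟨z, hz, -⟩ := hensels_lemma (F := F) (a := a) (by
    simpa [coe_aeval_eq_eval, hFa'] using hFa)
  refine ⟨z, ?_⟩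
  rw [coe_aeval_eq_eval] at hz
  rw [← PadicInt.algebraMap_apply, eval_map_apply, hz, map_zero]

theorem norm_taylor_coeff_le {K : Type*} [NormedField K] [IsUltrametricDist K] (f : Polynomial K)
    {t : K} (ht : ‖t‖ ≤ 1) {c : ℝ} (hc : ∀ j, ‖f.coeff j‖ ≤ c) (k : ℕ) :
    ‖(taylor t f).coeff k‖ ≤ c := by
  have hc0 : 0 ≤ c := (norm_nonneg _).trans (hc 0)
  rw [taylor_coeff, eval_eq_sum_range]
  refine IsUltrametricDist.norm_sum_le_of_forall_le_of_nonneg hc0 fun j _ => ?_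
  rw [hasseDeriv_coeff, norm_mul, norm_mul, norm_pow]
  calc ‖(((j + k).choose k : ℕ) : K)‖ * ‖f.coeff (j + k)‖ * ‖t‖ ^ j ≤ 1 * c * 1 := by
        gcongr
        · exact IsUltrametricDist.norm_natCast_le_one K _
        · exact hc _
        · exact pow_le_one₀ (norm_nonneg _) ht
    _ = c := by ring

theorem eval_iterate_derivative_eq_factorial_mul_taylor_coeff {R : Type*} [CommRing R]
    (f : Polynomial R) (t : R) (k : ℕ) :
    (derivative^[k] f).eval t = (k.factorial : R) * (taylor t f).coeff k := by
  rw [taylor_coeff, ← factorial_smul_hasseDeriv]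
  simp

theorem norm_coeff_le_lamPlus {p : ℕ} [Fact p.Prime] (φ : Polynomial ℚ_[p]) (j : ℕ) :
    ‖φ.coeff j‖ ≤ lamPlus φ := by
  rcases le_or_gt j φ.natDegree with hj | hj
  · refine le_trans ?_ (le_max_left _ _)
    exact_mod_cast Finset.le_sup (f := fun j => ‖φ.coeff j‖₊) (Finset.mem_range_succ_iff.2 hj)
  · rw [coeff_eq_zero_of_natDegree_lt hj, norm_zero]
    exact zero_le_one.trans (le_max_right _ _)

theorem henselDelta_eq_norm_taylor_coeff {p : ℕ} [Fact p.Prime] (φ : Polynomial ℚ_[p])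
    (t₀ : ℤ_[p]) (L : ℕ) :
    henselDelta φ t₀ L =
      ‖(taylor (t₀ : ℚ_[p]) φ).coeff 0 * ((taylor (t₀ : ℚ_[p]) φ).coeff 1)⁻¹‖ *
        ‖((taylor (t₀ : ℚ_[p]) φ).coeff L)⁻¹‖ := by
  have hL : (L.factorial : ℚ_[p]) ≠ 0 := by exact_mod_cast L.factorial_ne_zero
  rw [henselDelta, eval_iterate_derivative_eq_factorial_mul_taylor_coeff, mul_div_cancel_left₀ _ hL,
    taylor_coeff_zero, taylor_coeff_one, norm_mul]

theorem henselDeltaK_eq_norm_taylor_coeff {p : ℕ} [Fact p.Prime] (φ : Polynomial ℚ_[p])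
    (t₀ : ℤ_[p]) (k : ℕ) :
    henselDeltaK φ t₀ k =
      ‖(taylor (t₀ : ℚ_[p]) φ).coeff (k + 1) * ((taylor (t₀ : ℚ_[p]) φ).coeff k)⁻¹ *
        ((taylor (t₀ : ℚ_[p]) φ).coeff 0 * ((taylor (t₀ : ℚ_[p]) φ).coeff 1)⁻¹)‖ := by
  have hk : (k.factorial : ℚ_[p]) ≠ 0 := by exact_mod_cast k.factorial_ne_zero
  have hk1 : (k : ℚ_[p]) + 1 ≠ 0 := by exact_mod_cast k.succ_ne_zero
  rw [henselDeltaK, eval_iterate_derivative_eq_factorial_mul_taylor_coeff,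
    eval_iterate_derivative_eq_factorial_mul_taylor_coeff, taylor_coeff_zero, taylor_coeff_one,
    Nat.factorial_succ]
  congr 2
  push_cast
  rw [mul_inv]
  field_simp

/-- Higher order Hensel lemma (Lemma 6.3): under the stated smallness conditions on
`λ₊·δ` and the `δ_k`, the polynomial `φ` has a root `t ∈ ℚ_p` with
`|t - t₀| ≤ |φ(t₀)·φ'(t₀)⁻¹|`. -/
theorem higher_order_hensel (p : ℕ) [Fact p.Prime] (L : ℕ) (hL : 1 ≤ L)
    (φ : Polynomial ℚ_[p]) (t₀ : ℤ_[p])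
    (hder : ∀ k : ℕ, 1 ≤ k → k ≤ L → (derivative^[k] φ).eval (t₀ : ℚ_[p]) ≠ 0)
    (hL1 : L = 1 → lamPlus φ * henselDelta φ t₀ L < 1)
    (hL2 : 2 ≤ L →
      lamPlus φ * henselDelta φ t₀ L ≤ 1 ∧ henselDeltaK φ t₀ 1 < 1 ∧
        ∀ k : ℕ, 2 ≤ k → k ≤ L - 1 → henselDeltaK φ t₀ k ≤ 1) :
    ∃ t : ℚ_[p], φ.eval t = 0 ∧
      ‖t - (t₀ : ℚ_[p])‖ ≤
        ‖φ.eval (t₀ : ℚ_[p]) * ((derivative φ).eval (t₀ : ℚ_[p]))⁻¹‖ := by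
  set a : ℕ → ℚ_[p] := (taylor (t₀ : ℚ_[p]) φ).coeff with ha
  have ha_ne : ∀ k, 1 ≤ k → k ≤ L → a k ≠ 0 := fun k hk hkL =>
    right_ne_zero_of_mul
      (eval_iterate_derivative_eq_factorial_mul_taylor_coeff φ (t₀ : ℚ_[p]) k ▸ hder k hk hkL)
  have ha_le : ∀ k, ‖a k‖ ≤ lamPlus φ :=
    norm_taylor_coeff_le φ t₀.norm_le_one (norm_coeff_le_lamPlus φ)
  have ha1 : a 1 ≠ 0 := ha_ne 1 le_rfl hL
  have haL : a L ≠ 0 := ha_ne L hL le_rfl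
  simp only [henselDelta_eq_norm_taylor_coeff, henselDeltaK_eq_norm_taylor_coeff, ← ha] at hL1 hL2
  rw [← taylor_coeff_zero, ← taylor_coeff_one, ← ha]
  set x : ℚ_[p] := a 0 * (a 1)⁻¹ with hx
  by_cases ha0 : a 0 = 0
  · exact ⟨t₀, by rwa [ha, taylor_coeff_zero] at ha0, by simp⟩
  have hxL : ‖x‖ = ‖a L‖ * (‖x‖ * ‖(a L)⁻¹‖) := by
    rw [norm_inv]
    field_simp [norm_ne_zero_iff.2 haL]
  have hδ : lamPlus φ * (‖x‖ * ‖(a L)⁻¹‖) ≤ 1 := by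
    rcases hL.eq_or_lt with h | h
    · exact (hL1 h.symm).le
    · exact (hL2 h).1
  have hx1 : ‖x‖ ≤ 1 := by
    rw [hxL]
    exact (mul_le_mul_of_nonneg_right (ha_le L) (by positivity)).trans hδ
  -- the normalised coefficients, i.e. those of `φ (t₀ + x s) / φ t₀` as a polynomial in `s`
  let b : ℕ → ℚ_[p] := fun k => (a 0)⁻¹ * (a k * x ^ k)
  have hb0 : b 0 = 1 := by simp [b, ha0]
  have hb1 : b 1 = 1 := by
    simp only [b, hx]
    field_simp
  have hb_succ : ∀ k, 1 ≤ k → k ≤ L → ‖b (k + 1)‖ = ‖a (k + 1) * (a k)⁻¹ * x‖ * ‖b k‖ := by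
    intro k hk hkL
    have := ha_ne k hk hkL
    rw [← norm_mul]
    congr 1
    simp only [b]
    field_simp
    ring
  have hb_low : ∀ k, 2 ≤ k → k ≤ L → ‖b k‖ < 1 := by
    intro k hk
    induction k, hk using Nat.le_induction with
    | base =>
      intro h
      rw [hb_succ 1 le_rfl (by omega), hb1, norm_one, mul_one]
      exact (hL2 h).2.1
    | succ k hk ih =>
      intro h
      rw [hb_succ k (by omega) (by omega)]
      exact mul_lt_one_of_nonneg_of_lt_one_right ((hL2 (by omega)).2.2 k hk (by omega))
        (norm_nonneg _) (ih (by omega))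
  have hb_high : ∀ m, ‖b (L + 1 + m)‖ < 1 := by
    intro m
    have hfac : ‖b (L + 1 + m)‖ = ‖a (L + 1 + m)‖ * (‖x‖ * ‖(a L)⁻¹‖) * ‖b L‖ * ‖x‖ ^ m := by
      rw [← norm_pow, ← norm_mul, ← norm_mul, ← norm_mul, ← norm_mul]
      congr 1
      simp only [b]
      field_simp
      ring
    have hle : ‖a (L + 1 + m)‖ * (‖x‖ * ‖(a L)⁻¹‖) ≤ lamPlus φ * (‖x‖ * ‖(a L)⁻¹‖) :=
      mul_le_mul_of_nonneg_right (ha_le _) (by positivity)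
    have hlt : ‖a (L + 1 + m)‖ * (‖x‖ * ‖(a L)⁻¹‖) * ‖b L‖ < 1 := by
      rcases hL.eq_or_lt with h | h
      · have hbL : b L = 1 := h ▸ hb1
        rw [hbL, norm_one, mul_one]
        exact hle.trans_lt (hL1 h.symm)
      · exact mul_lt_one_of_nonneg_of_lt_one_right (hle.trans hδ) (norm_nonneg _)
          (hb_low L h le_rfl)
    rw [hfac]
    exact mul_lt_one_of_nonneg_of_lt_one_left (by positivity) hlt
      (pow_le_one₀ (norm_nonneg _) hx1)
  have hb : ∀ k, (C (a 0)⁻¹ * (taylor (t₀ : ℚ_[p]) φ).comp (C x * X)).coeff k = b k := fun k => by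
    rw [coeff_C_mul, comp_C_mul_X_coeff]
  obtain ⟨s, hs⟩ := exists_padicInt_root_of_linear_reduction
    (C (a 0)⁻¹ * (taylor (t₀ : ℚ_[p]) φ).comp (C x * X))
    (by rw [hb, hb0, norm_one]) (by rw [hb, hb1, norm_one]) (fun k hk => by
      rw [hb]
      rcases le_or_gt k L with h | h
      · exact hb_low k hk h
      · obtain ⟨m, rfl⟩ := Nat.exists_eq_add_of_le (Nat.succ_le_of_lt h)
        exact hb_high m)
  refine ⟨x * s + t₀, ?_, ?_⟩
  · simpa [eval_comp, taylor_eval, ha0] using hs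
  · rw [add_sub_cancel_right, norm_mul]
    exact mul_le_of_le_one_right (norm_nonneg _) s.norm_le_one
end

section
/- Let p be a prime, let r ≥ 1 be an integer, and let a₀, b₀ be integers with p ∤ a₀ and p ∤ b₀ such that the congruence 3·a₀·s² + b₀ ≡ 0 (mod p) has no integer solution s. Let P(t) = a·t³ + b·t ∈ ℚ_p[X], where a = a₀·p^{-(3r−2)} and b = b₀·p^{-r} (so |a| = p^{3r−2} and |b| = p^{r}). Then inf_{t ∈ ℤ_p} max( |P'(t)|, |P''(t)/2|^{1/2}, |P'''(t)/6|^{1/3} ) = p^{r}, i.e. H_P = p^r. -/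
open Polynomial

/-- If `3a₀s² + b₀ ≡ 0 (mod p)` has no integer solution, then `3a₀s² + b₀` has norm at least `1`
for every `s ∈ ℚ_p`. -/
theorem one_le_norm_three_mul_sq_add (p : ℕ) [Fact p.Prime] (a₀ b₀ : ℤ)
    (ha₀ : ¬ (p : ℤ) ∣ a₀) (hcong : ¬ ∃ s : ℤ, (p : ℤ) ∣ (3 * a₀ * s ^ 2 + b₀)) (s : ℚ_[p]) :
    1 ≤ ‖3 * (a₀ : ℚ_[p]) * s ^ 2 + (b₀ : ℚ_[p])‖ := by
  have hp : p.Prime := Fact.out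
  have hp2 : (2 : ℝ) ≤ p := by exact_mod_cast hp.two_le
  by_cases hs : ‖s‖ ≤ 1
  · by_contra! h
    obtain ⟨s, rfl⟩ : ∃ x : ℤ_[p], (x : ℚ_[p]) = s := ⟨⟨s, hs⟩, rfl⟩
    have h' : ‖3 * (a₀ : ℤ_[p]) * s ^ 2 + (b₀ : ℤ_[p])‖ < 1 := by
      rw [PadicInt.norm_def]
      push_cast
      exact h
    rw [← PadicInt.mem_nonunits, ← IsLocalRing.mem_maximalIdeal,
      ← PadicInt.ker_toZMod, RingHom.mem_ker] at h'
    obtain ⟨n, hn⟩ := ZMod.intCast_surjective (PadicInt.toZMod s)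
    refine hcong ⟨n, (ZMod.intCast_zmod_eq_zero_iff_dvd _ p).1 ?_⟩
    rw [map_add, map_mul, map_mul, map_pow, map_intCast, map_intCast, ← hn,
      map_ofNat PadicInt.toZMod 3] at h'
    push_cast
    exact h'
  · have hsp : (p : ℝ) ≤ ‖s‖ := by
      by_contra! h
      exact hs (by simpa using (Padic.norm_le_pow_iff_norm_lt_pow_add_one s 0).2 (by simpa using h))
    have ha : ‖(a₀ : ℚ_[p])‖ = 1 :=
      le_antisymm (Padic.norm_int_le_one a₀)
        (not_lt.1 fun h => ha₀ ((Padic.norm_intCast_lt_one_iff (p := p)).1 h))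
    have h3 : (p : ℝ)⁻¹ ≤ ‖(3 : ℚ_[p])‖ := by
      by_cases h : p = 3
      · subst h
        exact_mod_cast (Padic.norm_p (p := 3)).ge
      · have h1 : ‖((3 : ℕ) : ℚ_[p])‖ = 1 :=
          Padic.norm_natCast_eq_one_iff.2 ((Nat.coprime_primes hp Nat.prime_three).2 h)
        rw [Nat.cast_ofNat] at h1
        rw [h1]
        exact inv_le_one_of_one_le₀ (by linarith)
    have hlt : 1 < ‖3 * (a₀ : ℚ_[p]) * s ^ 2‖ := by
      rw [norm_mul, norm_mul, norm_pow, ha, mul_one]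
      calc (1 : ℝ) < p := by linarith
        _ = (p : ℝ)⁻¹ * (p : ℝ) ^ 2 := by field_simp
        _ ≤ ‖(3 : ℚ_[p])‖ * ‖s‖ ^ 2 := by gcongr
    have hb := Padic.norm_int_le_one (p := p) b₀
    rw [IsUltrametricDist.norm_add_eq_max_of_norm_ne_norm (hb.trans_lt hlt).ne']
    exact hlt.le.trans (le_max_left _ _)

/-- The example of Section 5: for `P(t) = a·t³ + b·t` with `|a| = p^{3r-2}`, `|b| = p^r`,
`a = a₀·p^{-(3r-2)}`, `b = b₀·p^{-r}`, and `3a₀s² + b₀ ≡ 0 (mod p)` unsolvable, one has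
`H_P = inf_{t ∈ ℤ_p} max(|P'(t)|, |P''(t)/2|^{1/2}, |P'''(t)/6|^{1/3}) = p^r`. -/
theorem H_example_cubic (p : ℕ) [Fact p.Prime] (r : ℕ) (hr : 1 ≤ r) (a₀ b₀ : ℤ)
    (ha₀ : ¬ (p : ℤ) ∣ a₀) (hb₀ : ¬ (p : ℤ) ∣ b₀)
    (hcong : ¬ ∃ s : ℤ, (p : ℤ) ∣ (3 * a₀ * s ^ 2 + b₀))
    (a b : ℚ_[p])
    (ha : a = (a₀ : ℚ_[p]) * (p : ℚ_[p]) ^ (-(3 * (r : ℤ) - 2)))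
    (hb : b = (b₀ : ℚ_[p]) * (p : ℚ_[p]) ^ (-(r : ℤ)))
    (P : Polynomial ℚ_[p])
    (hP : P = Polynomial.C a * Polynomial.X ^ 3 + Polynomial.C b * Polynomial.X) :
    ⨅ t : ℤ_[p],
        max (max ‖(derivative P).eval (t : ℚ_[p])‖
            (‖(derivative^[2] P).eval (t : ℚ_[p]) / 2‖ ^ ((1 : ℝ) / 2)))
          (‖(derivative^[3] P).eval (t : ℚ_[p]) / 6‖ ^ ((1 : ℝ) / 3)) =
      (p : ℝ) ^ r := by
  have hp : p.Prime := Fact.out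
  have hp1 : (1 : ℝ) ≤ p := by exact_mod_cast hp.one_le
  have hp0 : (p : ℚ_[p]) ≠ 0 := by exact_mod_cast hp.ne_zero
  have hd1 : ∀ t : ℚ_[p], (derivative P).eval t = 3 * a * t ^ 2 + b := by
    intro t
    simp [hP]
    ring
  have hd2 : ∀ t : ℚ_[p], (derivative^[2] P).eval t = 6 * a * t := by
    intro t
    simp [hP]
    ring
  have hd3 : ∀ t : ℚ_[p], (derivative^[3] P).eval t = 6 * a := by
    intro t
    simp [hP]
    ring
  have hbnorm : ‖b‖ = (p : ℝ) ^ r := by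
    have h1 : ‖(b₀ : ℚ_[p])‖ = 1 :=
      le_antisymm (Padic.norm_int_le_one b₀)
        (not_lt.1 fun h => hb₀ ((Padic.norm_intCast_lt_one_iff (p := p)).1 h))
    rw [hb, norm_mul, h1, Padic.norm_p_zpow]
    simp
  have hanorm : ‖a‖ ≤ ((p : ℝ) ^ r) ^ 3 := by
    rw [ha, norm_mul, Padic.norm_p_zpow, neg_neg, ← pow_mul, ← zpow_natCast]
    calc ‖(a₀ : ℚ_[p])‖ * (p : ℝ) ^ (3 * (r : ℤ) - 2)
        ≤ 1 * (p : ℝ) ^ (3 * (r : ℤ) - 2) := by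
          gcongr
          exact Padic.norm_int_le_one a₀
      _ ≤ (p : ℝ) ^ ((r * 3 : ℕ) : ℤ) := by
          rw [one_mul]
          exact zpow_le_zpow_right₀ hp1 (by push_cast; omega)
  apply le_antisymm
  · refine ciInf_le_of_le ⟨0, ?_⟩ 0 ?_
    · rintro _ ⟨t, rfl⟩
      exact (norm_nonneg _).trans ((le_max_left _ _).trans (le_max_left _ _))
    · rw [hd1, hd2, hd3, mul_div_cancel_left₀ a (by norm_num : (6 : ℚ_[p]) ≠ 0)]
      refine max_le (max_le ?_ ?_) ?_
      · simp [hbnorm]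
      · simp
      · calc ‖a‖ ^ ((1 : ℝ) / 3) ≤ (((p : ℝ) ^ r) ^ 3) ^ ((1 : ℝ) / 3) := by gcongr
          _ = (p : ℝ) ^ r := by
            rw [one_div]
            exact_mod_cast Real.pow_rpow_inv_natCast (by positivity : (0 : ℝ) ≤ (p : ℝ) ^ r)
              three_ne_zero
  · refine le_ciInf fun t => le_max_of_le_left (le_max_of_le_left ?_)
    have key : 3 * a * (t : ℚ_[p]) ^ 2 + b = (p : ℚ_[p]) ^ (-(r : ℤ)) *
        (3 * (a₀ : ℚ_[p]) * ((t : ℚ_[p]) * (p : ℚ_[p]) ^ (-((r : ℤ) - 1))) ^ 2 + b₀) := by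
      have he : (p : ℚ_[p]) ^ (-(3 * (r : ℤ) - 2)) =
          (p : ℚ_[p]) ^ (-(r : ℤ)) * ((p : ℚ_[p]) ^ (-((r : ℤ) - 1))) ^ 2 := by
        rw [← zpow_natCast, ← zpow_mul, ← zpow_add₀ hp0]
        congr 1
        push_cast
        ring
      rw [ha, hb, he]
      ring
    rw [hd1, key, norm_mul, Padic.norm_p_zpow, neg_neg, zpow_natCast]
    exact le_mul_of_one_le_right (by positivity)
      (one_le_norm_three_mul_sq_add p a₀ b₀ ha₀ hcong _)
end
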